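/- arXiv:2203.11186 — 2 statements merged into one kernel-verified Lean document; each statement's English description precedes it below -/
import Mathlib

section
/- Let n ≥ 2 and let R = ℂ⟦x₁,…,xₙ⟧ be the formal power series ring in n variables over ℂ. If I ⊆ R is an ideal generated by a regular sequence of length 2 and J ⊆ R is an ideal generated by a regular sequence of length n, then the R-module Tor₁^R(R/I, R/J) has finite length and length_R Tor₁^R(R/I, R/J) = 2 · length_R ( R/(I+J) ). -/
open CategoryTheory

section Socle

open Submodule RingTheory.Sequence IsLocalRing
open scoped Pointwise

variable {R : Type*} [CommRing R]

theorem LinearMap.nonempty_linearEquiv_of_ker_eq {W M N : Type*} [AddCommGroup W] [Module R W]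
    [AddCommGroup M] [Module R M] [AddCommGroup N] [Module R N] {f : W →ₗ[R] M} {g : W →ₗ[R] N}
    (hf : Function.Surjective f) (hg : Function.Surjective g)
    (h : ∀ w, f w = 0 ↔ g w = 0) : Nonempty (M ≃ₗ[R] N) :=
  ⟨(f.quotKerEquivOfSurjective hf).symm ≪≫ₗ
    quotEquivOfEq _ _ (by ext w; simpa using h w) ≪≫ₗ g.quotKerEquivOfSurjective hg⟩

theorem LinearEquiv.nonempty_torsionBySet_equiv {M N : Type*} [AddCommGroup M] [Module R M]
    [AddCommGroup N] [Module R N] (e : M ≃ₗ[R] N) (s : Set R) :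
    Nonempty (torsionBySet R M s ≃ₗ[R] torsionBySet R N s) := by
  refine ⟨e.ofSubmodules _ _ ?_⟩
  ext x
  simp only [mem_map_equiv, mem_torsionBySet_iff, ← map_smul, e.symm.map_eq_zero_iff]

/-- Exchanging a regular element of `I` does not change the `I`-torsion of the quotient. -/
theorem nonempty_torsionBySet_quotSMulTop_equiv {M : Type*} [AddCommGroup M] [Module R M]
    {I : Ideal R} {x y : R} (hxI : x ∈ I) (hyI : y ∈ I)
    (hx : IsSMulRegular M x) (hy : IsSMulRegular M y) :
    Nonempty (torsionBySet R (QuotSMulTop x M) (I : Set R) ≃ₗ[R]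
      torsionBySet R (QuotSMulTop y M) (I : Set R)) := by
  have key : ∀ {x y : R}, IsSMulRegular M x → ∀ {p q : M}, y • p = x • q →
      mkQ (x • ⊤ : Submodule R M) p ∈ torsionBySet R (QuotSMulTop x M) (I : Set R) →
      mkQ (y • ⊤ : Submodule R M) q ∈ torsionBySet R (QuotSMulTop y M) (I : Set R) := by
    intro x y hx p q h hp
    rw [mem_torsionBySet_iff] at hp ⊢
    intro r
    have := hp r
    rw [← map_smul, mkQ_apply, Quotient.mk_eq_zero, mem_smul_pointwise_iff_exists] at this ⊢
    obtain ⟨w, -, hw⟩ := this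
    refine ⟨w, trivial, hx ?_⟩
    change x • y • w = x • (r : R) • q
    rw [smul_comm x y, hw, smul_comm x, ← h, smul_comm]
  have lift : ∀ {x y : R}, y ∈ I → ∀ {p : M},
      mkQ (x • ⊤ : Submodule R M) p ∈ torsionBySet R (QuotSMulTop x M) (I : Set R) →
      ∃ q, y • p = x • q := by
    intro x y hy p hp
    have := (mem_torsionBySet_iff _ _).1 hp ⟨y, hy⟩
    rw [← map_smul, mkQ_apply, Quotient.mk_eq_zero, mem_smul_pointwise_iff_exists] at this
    obtain ⟨w, -, hw⟩ := this
    exact ⟨w, hw.symm⟩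
  have ker : ∀ {x y : R}, IsSMulRegular M x → ∀ {p q : M}, y • p = x • q →
      mkQ (x • ⊤ : Submodule R M) p = 0 → mkQ (y • ⊤ : Submodule R M) q = 0 := by
    intro x y hx p q h hp
    rw [mkQ_apply, Quotient.mk_eq_zero, mem_smul_pointwise_iff_exists] at hp ⊢
    obtain ⟨w, -, rfl⟩ := hp
    refine ⟨w, trivial, hx ?_⟩
    change x • y • w = x • q
    rw [← h, smul_comm]
  let W : Submodule R (M × M) :=
    LinearMap.ker (y • LinearMap.fst R M M - x • LinearMap.snd R M M) ⊓
      ((torsionBySet R (QuotSMulTop x M) (I : Set R)).comap (mkQ _ ∘ₗ LinearMap.fst R M M))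
  have hW : ∀ w : M × M, w ∈ W ↔ y • w.1 = x • w.2 ∧
      mkQ (x • ⊤ : Submodule R M) w.1 ∈ torsionBySet R (QuotSMulTop x M) (I : Set R) := by
    intro w
    simp [W, sub_eq_zero]
  let f : W →ₗ[R] torsionBySet R (QuotSMulTop x M) (I : Set R) :=
    (mkQ _ ∘ₗ LinearMap.fst R M M ∘ₗ W.subtype).codRestrict _ fun w ↦ ((hW w).1 w.2).2
  let g : W →ₗ[R] torsionBySet R (QuotSMulTop y M) (I : Set R) :=
    (mkQ _ ∘ₗ LinearMap.snd R M M ∘ₗ W.subtype).codRestrict _ fun w ↦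
      key hx ((hW w).1 w.2).1 ((hW w).1 w.2).2
  refine LinearMap.nonempty_linearEquiv_of_ker_eq (f := f) (g := g) ?_ ?_ ?_
  · rintro ⟨p, hp⟩
    obtain ⟨p, rfl⟩ := mkQ_surjective _ p
    obtain ⟨q, hq⟩ := lift hyI hp
    exact ⟨⟨(p, q), (hW _).2 ⟨hq, hp⟩⟩, rfl⟩
  · rintro ⟨q, hq⟩
    obtain ⟨q, rfl⟩ := mkQ_surjective _ q
    obtain ⟨p, hp⟩ := lift hxI hq
    exact ⟨⟨(p, q), (hW _).2 ⟨hp.symm, key hy hp hq⟩⟩, rfl⟩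
  · rintro ⟨⟨p, q⟩, hw⟩
    have h := ((hW _).1 hw).1
    refine ⟨fun h0 ↦ Subtype.ext (ker hx h (congrArg Subtype.val h0)),
      fun h0 ↦ Subtype.ext (ker hy h.symm (congrArg Subtype.val h0))⟩

theorem exists_isSMulRegular_and_of_mem {M N : Type*} [AddCommGroup M] [Module R M]
    [AddCommGroup N] [Module R N] [IsNoetherianRing R] [Module.Finite R M] [Module.Finite R N]
    {I : Ideal R} {x y : R} (hxI : x ∈ I) (hyI : y ∈ I)
    (hx : IsSMulRegular M x) (hy : IsSMulRegular N y) :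
    ∃ z ∈ I, IsSMulRegular M z ∧ IsSMulRegular N z := by
  by_contra! H
  have hM := biUnion_associatedPrimes_eq_compl_regular M (R := R)
  have hN := biUnion_associatedPrimes_eq_compl_regular N (R := R)
  have hsub : (I : Set R) ⊆
      ⋃ p ∈ associatedPrimes R M ∪ associatedPrimes R N, (id p : Ideal R) := by
    intro z hz
    rw [Set.biUnion_union]
    simp only [id]
    rw [hM, hN]
    by_cases h : IsSMulRegular M z
    · exact Or.inr (H z hz h)
    · exact Or.inl h
  obtain ⟨p, hp, hIp⟩ := (Ideal.subset_union_prime_finite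
    ((associatedPrimes.finite R M).union (associatedPrimes.finite R N)) (f := id) 0 0
    (fun p hp _ _ ↦ hp.elim (fun h ↦ h.isPrime) (fun h ↦ h.isPrime))).1 hsub
  rcases hp with hp | hp
  · have : x ∈ ⋃ p ∈ associatedPrimes R M, (p : Set R) := Set.mem_biUnion hp (hIp hxI)
    rw [hM] at this
    exact this hx
  · have : y ∈ ⋃ p ∈ associatedPrimes R N, (p : Set R) := Set.mem_biUnion hp (hIp hyI)
    rw [hN] at this
    exact this hy

variable [IsLocalRing R]

theorem RingTheory.Sequence.IsRegular.mem_maximalIdeal {M : Type*} [AddCommGroup M] [Module R M]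
    {rs : List R} (h : IsRegular M rs) {r : R} (hr : r ∈ rs) : r ∈ maximalIdeal R := by
  refine le_maximalIdeal (J := Ideal.ofList rs) (fun h1 ↦ h.top_ne_smul ?_)
    (Ideal.subset_span hr)
  rw [h1, top_smul]

variable [IsNoetherianRing R]

theorem RingTheory.Sequence.IsRegular.isSMulRegular_quotient_tail
    {M : Type*} [AddCommGroup M] [Module R M]
    [Module.Finite R M] {r : R} {rs : List R} (h : IsRegular M (r :: rs)) :
    IsWeaklyRegular M rs ∧ IsSMulRegular (M ⧸ (Ideal.ofList rs • ⊤ : Submodule R M)) r := by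
  have := (isRegular_of_perm h (List.perm_append_singleton r rs).symm).toIsWeaklyRegular
  rwa [isWeaklyRegular_append_iff, isWeaklyRegular_singleton_iff] at this

theorem RingTheory.Sequence.IsRegular.replace_head {M : Type*} [AddCommGroup M] [Module R M]
    [Module.Finite R M] {r z : R} {rs : List R} (h : IsRegular M (r :: rs))
    (hz : z ∈ maximalIdeal R)
    (hz' : IsSMulRegular (M ⧸ (Ideal.ofList rs • ⊤ : Submodule R M)) z) :
    IsRegular M (z :: rs) := by
  have := h.nontrivial
  refine isRegular_of_perm (rs := rs ++ [z]) ?_ (List.perm_append_singleton z rs)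
  refine IsRegular.of_isWeaklyRegular_of_mem_maximalIdeal _ (fun r hr ↦ ?_) ?_
  · rcases List.mem_append.1 hr with hr | hr
    · exact h.mem_maximalIdeal (List.mem_cons_of_mem _ hr)
    · rwa [List.mem_singleton.1 hr]
  · rw [isWeaklyRegular_append_iff, isWeaklyRegular_singleton_iff]
    exact ⟨h.isSMulRegular_quotient_tail.1, hz'⟩

/-- The socle of the quotient by a regular sequence depends only on the length of the sequence. -/
theorem nonempty_socle_quotient_equiv_of_isRegular (n : ℕ) {M : Type*} [AddCommGroup M]
    [Module R M] [Module.Finite R M] {rs ss : List R} (hrs : IsRegular M rs)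
    (hss : IsRegular M ss) (hr : rs.length = n) (hs : ss.length = n) :
    Nonempty (torsionBySet R (M ⧸ (Ideal.ofList rs • ⊤ : Submodule R M))
        (maximalIdeal R : Set R) ≃ₗ[R]
      torsionBySet R (M ⧸ (Ideal.ofList ss • ⊤ : Submodule R M)) (maximalIdeal R : Set R)) := by
  induction n generalizing M rs ss with
  | zero =>
    rw [List.length_eq_zero_iff] at hr hs
    subst hr hs
    exact ⟨.refl _ _⟩
  | succ n ih =>
    obtain ⟨r, rs, rfl⟩ := List.exists_cons_of_length_eq_add_one hr
    obtain ⟨s, ss, rfl⟩ := List.exists_cons_of_length_eq_add_one hs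
    have hrm := hrs.mem_maximalIdeal List.mem_cons_self
    have hsm := hss.mem_maximalIdeal List.mem_cons_self
    have hr' := hrs.isSMulRegular_quotient_tail.2
    have hs' := hss.isSMulRegular_quotient_tail.2
    obtain ⟨z, hzm, hzr, hzs⟩ := exists_isSMulRegular_and_of_mem hrm hsm hr' hs'
    have change_head : ∀ {r : R} {rs : List R}, r ∈ maximalIdeal R →
        IsSMulRegular (M ⧸ (Ideal.ofList rs • ⊤ : Submodule R M)) r →
        IsSMulRegular (M ⧸ (Ideal.ofList rs • ⊤ : Submodule R M)) z →
        Nonempty (torsionBySet R (M ⧸ (Ideal.ofList (r :: rs) • ⊤ : Submodule R M))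
            (maximalIdeal R : Set R) ≃ₗ[R]
          torsionBySet R (QuotSMulTop z M ⧸ (Ideal.ofList rs • ⊤ : Submodule R (QuotSMulTop z M)))
            (maximalIdeal R : Set R)) := by
      intro r rs hrm hr hz
      obtain ⟨e₁⟩ := (quotOfListConsSMulTopEquivQuotSMulTopOuter M r rs).nonempty_torsionBySet_equiv
        (maximalIdeal R : Set R)
      obtain ⟨e₂⟩ := nonempty_torsionBySet_quotSMulTop_equiv hrm hzm hr hz
      obtain ⟨e₃⟩ := ((quotOfListConsSMulTopEquivQuotSMulTopOuter M z rs).symm ≪≫ₗ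
        quotOfListConsSMulTopEquivQuotSMulTopInner M z rs).nonempty_torsionBySet_equiv
        (maximalIdeal R : Set R)
      exact ⟨e₁ ≪≫ₗ e₂ ≪≫ₗ e₃⟩
    obtain ⟨e₁⟩ := change_head hrm hr' hzr
    obtain ⟨e₂⟩ := change_head hsm hs' hzs
    obtain ⟨e⟩ := ih ((isRegular_cons_iff _ _ _).1 (hrs.replace_head hzm hzr)).2
      ((isRegular_cons_iff _ _ _).1 (hss.replace_head hzm hzs)).2 (by simpa using hr)
      (by simpa using hs)
    exact ⟨e₁ ≪≫ₗ e ≪≫ₗ e₂.symm⟩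

end Socle

section Koszul

open Submodule TensorProduct RingTheory.Sequence
open scoped Pointwise

universe u

/-- The first differential `(u, v) ↦ a u + b v` of the Koszul complex of `a, b` on `X`. -/
def koszulFst {R : Type*} [CommRing R] (a b : R) (X : Type*) [AddCommGroup X] [Module R X] :
    X × X →ₗ[R] X :=
  a • LinearMap.fst R X X + b • LinearMap.snd R X X

/-- The second differential `t ↦ (b t, -a t)` of the Koszul complex of `a, b` on `X`. -/
def koszulSnd {R : Type*} [CommRing R] (a b : R) (X : Type*) [AddCommGroup X] [Module R X] :
    X →ₗ[R] X × X :=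
  (b • LinearMap.id).prod (-(a • LinearMap.id))

section

variable {R : Type*} [CommRing R] (a b : R) {X : Type*} [AddCommGroup X] [Module R X]

@[simp]
theorem koszulFst_apply (x : X × X) : koszulFst a b X x = a • x.1 + b • x.2 := rfl

@[simp]
theorem koszulSnd_apply (t : X) : koszulSnd a b X t = (b • t, -(a • t)) := rfl

variable (X) in
/-- The first Koszul homology of `a, b` on `X`. -/
abbrev KoszulHomologyOne :=
  LinearMap.ker (koszulFst a b X) ⧸
    (LinearMap.range (koszulSnd a b X)).submoduleOf (LinearMap.ker (koszulFst a b X))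

theorem Submodule.mem_span_pair_smul_top_iff {a b : R} {x : X} :
    x ∈ (Ideal.span {a, b} • ⊤ : Submodule R X) ↔ ∃ p q : X, a • p + b • q = x := by
  rw [Ideal.span_insert, sup_smul, ideal_span_singleton_smul, ideal_span_singleton_smul,
    mem_sup]
  simp [mem_smul_pointwise_iff_exists]

theorem Ideal.Quotient.one_tmul_eq_zero_iff {I : Ideal R} {x : X} :
    (1 : R ⧸ I) ⊗ₜ[R] x = 0 ↔ x ∈ (I • ⊤ : Submodule R X) := by
  rw [← (quotTensorEquivQuotSMul X I).map_eq_zero_iff, quotTensorEquivQuotSMul_mk_one_tmul,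
    Quotient.mk_eq_zero]

theorem Ideal.Quotient.exists_one_tmul_eq {I : Ideal R} (t : (R ⧸ I) ⊗[R] X) :
    ∃ x : X, (1 : R ⧸ I) ⊗ₜ[R] x = t := by
  obtain ⟨x, hx⟩ := Submodule.Quotient.mk_surjective _ (quotTensorEquivQuotSMul X I t)
  refine ⟨x, (quotTensorEquivQuotSMul X I).injective ?_⟩
  rw [quotTensorEquivQuotSMul_mk_one_tmul, hx]

theorem RingTheory.Sequence.IsWeaklyRegular.exists_of_smul_add_smul_eq_zero {a b : R}
    (h : IsWeaklyRegular X [a, b]) {p q : X} (hpq : a • p + b • q = 0) :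
    ∃ s : X, p = b • s ∧ q = -(a • s) := by
  rw [isWeaklyRegular_cons_iff, isWeaklyRegular_singleton_iff] at h
  have hq : (Submodule.Quotient.mk q : QuotSMulTop a X) = 0 := by
    refine h.2.right_eq_zero_of_smul ?_
    rw [← Quotient.mk_smul, Quotient.mk_eq_zero, mem_smul_pointwise_iff_exists]
    exact ⟨-p, trivial, by rw [smul_neg]; exact neg_eq_of_add_eq_zero_right hpq⟩
  rw [Quotient.mk_eq_zero, mem_smul_pointwise_iff_exists] at hq
  obtain ⟨s, -, rfl⟩ := hq
  refine ⟨-s, h.1 ?_, by simp⟩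
  change a • p = a • b • (-s)
  rw [eq_neg_of_add_eq_zero_left hpq, smul_comm, smul_neg, smul_neg]

/-- The first homology of the reduction modulo `(a, b)` of an exact sequence
`P₂ → P₁ → P₀ → X → 0` is the first Koszul homology of `a, b` on `X`, provided that `a, b` is
regular on `P₀`. -/
theorem nonempty_homology_quotient_equiv_koszulHomologyOne {P₀ P₁ P₂ T₀ T₁ T₂ : Type*}
    [AddCommGroup P₀] [Module R P₀] [AddCommGroup P₁] [Module R P₁] [AddCommGroup P₂] [Module R P₂]
    [AddCommGroup T₀] [Module R T₀] [AddCommGroup T₁] [Module R T₁] [AddCommGroup T₂] [Module R T₂]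
    {f : P₂ →ₗ[R] P₁} {g : P₁ →ₗ[R] P₀} {ε : P₀ →ₗ[R] X} (hfg : Function.Exact f g)
    (hgε : Function.Exact g ε) (hε : Function.Surjective ε) {a b : R}
    (hab : IsWeaklyRegular P₀ [a, b]) {F : T₂ →ₗ[R] T₁} {G : T₁ →ₗ[R] T₀}
    {π₀ : P₀ →ₗ[R] T₀} {π₁ : P₁ →ₗ[R] T₁} {π₂ : P₂ →ₗ[R] T₂}
    (hπ₀ : ∀ x, π₀ x = 0 ↔ x ∈ (Ideal.span {a, b} • ⊤ : Submodule R P₀))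
    (hπ₁ : ∀ x, π₁ x = 0 ↔ x ∈ (Ideal.span {a, b} • ⊤ : Submodule R P₁))
    (hπ₁' : Function.Surjective π₁) (hπ₂ : Function.Surjective π₂)
    (hF : ∀ x, F (π₂ x) = π₁ (f x)) (hG : ∀ x, G (π₁ x) = π₀ (g x)) (hz : ∀ x, G (F x) = 0) :
    Nonempty ((LinearMap.ker G ⧸ LinearMap.range (F.codRestrict (LinearMap.ker G) hz)) ≃ₗ[R]
      KoszulHomologyOne a b X) := by
  let W : Submodule R (P₁ × (P₀ × P₀)) :=
    LinearMap.ker (g ∘ₗ LinearMap.fst R P₁ (P₀ × P₀) -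
      koszulFst a b P₀ ∘ₗ LinearMap.snd R P₁ (P₀ × P₀))
  have hW : ∀ w : P₁ × (P₀ × P₀), w ∈ W ↔ g w.1 = a • w.2.1 + b • w.2.2 := by
    intro w
    simp [W, sub_eq_zero]
  let α : W →ₗ[R] LinearMap.ker G :=
    (π₁ ∘ₗ LinearMap.fst R _ _ ∘ₗ W.subtype).codRestrict _ fun w ↦ by
      rw [LinearMap.mem_ker]
      change G (π₁ w.1.1) = 0
      rw [hG, hπ₀, mem_span_pair_smul_top_iff]
      exact ⟨_, _, ((hW _).1 w.2).symm⟩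
  let β : W →ₗ[R] LinearMap.ker (koszulFst a b X) :=
    (ε.prodMap ε ∘ₗ LinearMap.snd R _ _ ∘ₗ W.subtype).codRestrict _ fun w ↦ by
      rw [LinearMap.mem_ker]
      change a • ε w.1.2.1 + b • ε w.1.2.2 = 0
      rw [← map_smul, ← map_smul, ← map_add, ← (hW _).1 w.2]
      exact hgε.apply_apply_eq_zero _
  refine LinearMap.nonempty_linearEquiv_of_ker_eq (f := mkQ _ ∘ₗ α) (g := mkQ _ ∘ₗ β) ?_ ?_ ?_
  · refine (mkQ_surjective _).comp ?_
    rintro ⟨t, ht⟩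
    obtain ⟨z, rfl⟩ := hπ₁' t
    rw [LinearMap.mem_ker, hG, hπ₀, mem_span_pair_smul_top_iff] at ht
    obtain ⟨p, q, h⟩ := ht
    exact ⟨⟨(z, p, q), (hW _).2 h.symm⟩, rfl⟩
  · refine (mkQ_surjective _).comp ?_
    rintro ⟨⟨u, v⟩, h⟩
    obtain ⟨p, rfl⟩ := hε u
    obtain ⟨q, rfl⟩ := hε v
    rw [LinearMap.mem_ker, koszulFst_apply, ← map_smul, ← map_smul, ← map_add] at h
    obtain ⟨z, hz⟩ := (hgε _).1 h
    exact ⟨⟨(z, p, q), (hW _).2 hz⟩, rfl⟩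
  · rintro ⟨⟨z, p, q⟩, hw⟩
    rw [hW] at hw
    dsimp only at hw
    have hα : (∃ y, F.codRestrict _ hz y = α ⟨(z, p, q), (hW _).2 hw⟩) ↔
        ∃ w z₁ z₂, z = f w + (a • z₁ + b • z₂) := by
      constructor
      · rintro ⟨y, hy⟩
        obtain ⟨w, rfl⟩ := hπ₂ y
        have h : F (π₂ w) = π₁ z := congrArg Subtype.val hy
        rw [hF, eq_comm, ← sub_eq_zero, ← map_sub, hπ₁, mem_span_pair_smul_top_iff] at h
        obtain ⟨z₁, z₂, h⟩ := h
        exact ⟨w, z₁, z₂, by rw [h]; abel⟩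
      · rintro ⟨w, z₁, z₂, rfl⟩
        refine ⟨π₂ w, Subtype.ext ?_⟩
        change F (π₂ w) = π₁ (f w + (a • z₁ + b • z₂))
        rw [hF, map_add, left_eq_add, hπ₁, mem_span_pair_smul_top_iff]
        exact ⟨_, _, rfl⟩
    have hβ : (∃ t, koszulSnd a b X t = β ⟨(z, p, q), (hW _).2 hw⟩) ↔
        ∃ t, b • t = ε p ∧ -(a • t) = ε q :=
      exists_congr fun t ↦ Prod.ext_iff
    refine (Quotient.mk_eq_zero _).trans (Iff.trans ?_ (Quotient.mk_eq_zero _).symm)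
    refine hα.trans (Iff.trans ?_ hβ.symm)
    constructor
    · rintro ⟨w, z₁, z₂, rfl⟩
      rw [map_add, hfg.apply_apply_eq_zero, zero_add, map_add, map_smul, map_smul] at hw
      obtain ⟨s, hs₁, hs₂⟩ := hab.exists_of_smul_add_smul_eq_zero (p := p - g z₁) (q := q - g z₂)
        (by rw [smul_sub, smul_sub, sub_add_sub_comm, hw, sub_self])
      refine ⟨ε s, ?_, ?_⟩
      · rw [← map_smul, ← hs₁, map_sub, hgε.apply_apply_eq_zero, sub_zero]
      · rw [← map_smul, ← map_neg, ← hs₂, map_sub, hgε.apply_apply_eq_zero, sub_zero]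
    · rintro ⟨t, ht₁, ht₂⟩
      obtain ⟨s, rfl⟩ := hε t
      obtain ⟨z₁, h₁⟩ := (hgε (p - b • s)).1 (by rw [map_sub, map_smul, ht₁, sub_self])
      obtain ⟨z₂, h₂⟩ := (hgε (q + a • s)).1 (by rw [map_add, map_smul, ← ht₂, neg_add_cancel])
      obtain ⟨w, h⟩ := (hfg (z - (a • z₁ + b • z₂))).1 (by
        rw [map_sub, map_add, map_smul, map_smul, h₁, h₂, hw, smul_sub, smul_add, smul_comm a b]
        abel)
      exact ⟨w, z₁, z₂, by rw [h]; abel⟩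

end

/-- `Tor₁(R ⧸ (a, b), X)` is the first Koszul homology of `X` if `a, b` is a regular sequence. -/
theorem nonempty_tor_one_equiv_koszulHomologyOne {R : Type u} [CommRing R] {a b : R}
    (hab : IsWeaklyRegular R [a, b]) (X : Type u) [AddCommGroup X] [Module R X] :
    Nonempty ((((Tor (ModuleCat.{u} R) 1).obj (ModuleCat.of R (R ⧸ Ideal.span {a, b}))).obj
      (ModuleCat.of R X)) ≃ₗ[R] KoszulHomologyOne a b X) := by
  let P := projectiveResolution (ModuleCat.of R X)
  let F := (MonoidalCategory.tensoringLeft (ModuleCat.{u} R)).obj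
    (ModuleCat.of R (R ⧸ Ideal.span {a, b}))
  let K := (F.mapHomologicalComplex (ComplexShape.down ℕ)).obj P.complex
  have e₁ : ((Tor (ModuleCat.{u} R) 1).obj (ModuleCat.of R (R ⧸ Ideal.span {a, b}))).obj
      (ModuleCat.of R X) ≅ (K.sc' 2 1 0).homology :=
    P.isoLeftDerivedObj F 1 ≪≫
      ShortComplex.homologyMapIso (K.isoSc' 2 1 0 (by simp) (by simp))
  have e₂ := (e₁ ≪≫ (K.sc' 2 1 0).moduleCatHomologyIso).toLinearEquiv
  have hfg : Function.Exact (P.complex.d 2 1).hom (P.complex.d 1 0).hom :=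
    (ShortComplex.ShortExact.moduleCat_exact_iff_function_exact _).1 (P.exact_succ 0)
  have hgε : Function.Exact (P.complex.d 1 0).hom (P.π.f 0).hom :=
    (ShortComplex.ShortExact.moduleCat_exact_iff_function_exact _).1 P.exact₀
  have hε : Function.Surjective (P.π.f 0).hom :=
    (ModuleCat.epi_iff_surjective _).1 inferInstance
  have : Module.Projective R (P.complex.X 0) :=
    (IsProjective.iff_projective _).2 (P.projective 0)
  have hP : IsWeaklyRegular (P.complex.X 0) [a, b] :=
    ((TensorProduct.rid R (P.complex.X 0)).isWeaklyRegular_congr _).1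
      (hab.isWeaklyRegular_lTensor (M₂ := P.complex.X 0))
  obtain ⟨e₃⟩ := nonempty_homology_quotient_equiv_koszulHomologyOne hfg hgε hε hP
    (F := (K.d 2 1).hom) (G := (K.d 1 0).hom)
    (π₀ := TensorProduct.mk R (R ⧸ Ideal.span {a, b}) (P.complex.X 0) 1)
    (π₁ := TensorProduct.mk R (R ⧸ Ideal.span {a, b}) (P.complex.X 1) 1)
    (π₂ := TensorProduct.mk R (R ⧸ Ideal.span {a, b}) (P.complex.X 2) 1)
    (fun _ ↦ Ideal.Quotient.one_tmul_eq_zero_iff) (fun _ ↦ Ideal.Quotient.one_tmul_eq_zero_iff)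
    Ideal.Quotient.exists_one_tmul_eq Ideal.Quotient.exists_one_tmul_eq
    (fun _ ↦ rfl) (fun _ ↦ rfl) (fun x ↦ (K.sc' 2 1 0).moduleCat_zero_apply x)
  exact ⟨e₂ ≪≫ₗ e₃⟩

end Koszul

section Gorenstein

open Submodule RingTheory.Sequence IsLocalRing

section Residue

variable {k R M : Type*} [Field k] [CommRing R] [IsLocalRing R] [Algebra k R]

theorem IsFiniteLength.module_finite_of_residueField [AddCommGroup M] [Module R M] [Module k M]
    [IsScalarTower k R M] (hk : Function.Surjective (algebraMap k (ResidueField R)))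
    (h : IsFiniteLength R M) : Module.Finite k M := by
  have : Module.Finite (ResidueField k) (ResidueField R) := by
    refine Module.Finite.of_surjective (Algebra.linearMap (ResidueField k) (ResidueField R)) ?_
    intro x
    obtain ⟨c, rfl⟩ := hk x
    exact ⟨residue k c, rfl⟩
  have : IsFiniteLength k M := by
    rw [← Module.length_ne_top_iff] at h ⊢
    rw [length_restrictScalars k R M]
    exact WithTop.mul_ne_top h Module.length_ne_top
  have := (isFiniteLength_iff_isNoetherian_isArtinian.1 this).1
  infer_instance

/-- A nonzero submodule of an Artinian module meets the socle. -/
theorem exists_mem_torsionBySet_maximalIdeal [AddCommGroup M] [Module R M] [IsArtinian R M]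
    {N : Submodule R M} (hN : N ≠ ⊥) :
    ∃ x ∈ N, x ≠ 0 ∧ x ∈ torsionBySet R M (maximalIdeal R : Set R) := by
  obtain ⟨S, hS, hSN⟩ := (IsAtomic.eq_bot_or_exists_atom_le N).resolve_left hN
  have := (isSimpleModule_iff_isAtom (R := R)).2 hS
  obtain ⟨m, hm, ⟨e⟩⟩ := isSimpleModule_iff_quot_maximal.1 this
  obtain rfl := eq_maximalIdeal hm
  obtain ⟨x, hx, h0⟩ := S.exists_mem_ne_zero_of_ne_bot hS.1
  refine ⟨x, hSN hx, h0, (mem_torsionBySet_iff _ _).2 fun r ↦ ?_⟩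
  suffices (r : R) • (⟨x, hx⟩ : S) = 0 from congrArg Subtype.val this
  apply e.injective
  rw [map_smul, map_zero]
  obtain ⟨y, hy⟩ := Ideal.Quotient.mk_surjective (e ⟨x, hx⟩)
  rw [← hy]
  exact Ideal.Quotient.eq_zero_iff_mem.2 (Ideal.mul_mem_right _ _ r.2)

variable [IsNoetherianRing R] {rs xs : List R}

theorem RingTheory.Sequence.IsRegular.isArtinianRing_quotient_of_length_eq
    (hrs : IsRegular R rs) (hxs : IsRegular R xs)
    (hmax : Ideal.ofList xs = maximalIdeal R) (hlen : rs.length = xs.length) :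
    IsArtinianRing (R ⧸ Ideal.ofList rs) := by
  rw [isArtinianRing_iff_krullDimLE_zero, Ring.krullDimLE_iff]
  have h₁ := ringKrullDim_add_length_eq_ringKrullDim_of_isRegular rs hrs
  have h₂ := ringKrullDim_add_length_eq_ringKrullDim_of_isRegular xs hxs
  rw [hmax, ringKrullDim_eq_zero_of_isField
    ((Ideal.Quotient.maximal_ideal_iff_isField_quotient _).1 inferInstance), zero_add] at h₂
  rw [← h₂, hlen] at h₁
  exact (ENat.WithBot.add_natCast_cancel.1 (h₁.trans (zero_add _).symm)).le

/-- The quotient by a maximal regular sequence admits a nondegenerate trace form. -/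
theorem exists_dual_mul_nondegenerate
    (hk : Function.Surjective (algebraMap k (ResidueField R)))
    (hrs : IsRegular R rs) (hxs : IsRegular R xs)
    (hmax : Ideal.ofList xs = maximalIdeal R) (hlen : rs.length = xs.length) :
    ∃ φ : (R ⧸ Ideal.ofList rs) →ₗ[k] k, ∀ x, (∀ y, φ (x * y) = 0) → x = 0 := by
  have := hrs.isArtinianRing_quotient_of_length_eq hxs hmax hlen
  have : IsArtinian R (R ⧸ Ideal.ofList rs) :=
    isArtinian_of_surjective_algebraMap
      (Ideal.Quotient.mk_surjective (I := Ideal.ofList rs))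
  obtain ⟨e⟩ := nonempty_socle_quotient_equiv_of_isRegular _ hxs hrs rfl hlen
  obtain ⟨e'⟩ := (quotEquivOfEq (Ideal.ofList rs • ⊤) (Ideal.ofList rs)
    (by simp)).nonempty_torsionBySet_equiv (maximalIdeal R : Set R)
  have h1 : (mkQ _ 1 : R ⧸ (Ideal.ofList xs • ⊤ : Ideal R)) ∈
      torsionBySet R _ (maximalIdeal R : Set R) := by
    rw [mem_torsionBySet_iff]
    intro r
    rw [← map_smul, mkQ_apply, Quotient.mk_eq_zero, hmax]
    simp
  set s := e' (e ⟨_, h1⟩) with hs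
  have hs0 : s ≠ 0 := by
    intro h
    rw [hs, e'.map_eq_zero_iff, e.map_eq_zero_iff] at h
    have h : mkQ (Ideal.ofList xs • ⊤ : Ideal R) 1 = 0 := congrArg Subtype.val h
    rw [mkQ_apply, Quotient.mk_eq_zero, hmax] at h
    simp at h
  have hspan : ∀ x : torsionBySet R (R ⧸ Ideal.ofList rs) (maximalIdeal R : Set R),
      ∃ c : k, x = algebraMap k R c • s := by
    intro x
    obtain ⟨y, rfl⟩ := e'.surjective x
    obtain ⟨⟨z, hz⟩, rfl⟩ := e.surjective y
    obtain ⟨r, rfl⟩ := mkQ_surjective _ z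
    obtain ⟨c, hc⟩ := hk (residue R r)
    refine ⟨c, ?_⟩
    rw [hs, ← map_smul, ← map_smul]
    congr 2
    apply Subtype.ext
    change mkQ _ r = algebraMap k R c • mkQ _ 1
    rw [← map_smul, ← sub_eq_zero, ← map_sub, mkQ_apply, Quotient.mk_eq_zero, hmax]
    rw [IsScalarTower.algebraMap_apply k R (ResidueField R)] at hc
    simpa using Ideal.Quotient.eq.1 hc.symm
  obtain ⟨φ, hφ⟩ : ∃ φ : (R ⧸ Ideal.ofList rs) →ₗ[k] k, φ s ≠ 0 := by
    by_contra! h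
    exact hs0 (Subtype.ext ((Module.forall_dual_apply_eq_zero_iff k _).1 h))
  refine ⟨φ, fun x hx ↦ ?_⟩
  by_contra h0
  obtain ⟨y, hy, hy0, hyt⟩ := exists_mem_torsionBySet_maximalIdeal (R := R) (N := R ∙ x)
    (by simpa using h0)
  obtain ⟨r, rfl⟩ := mem_span_singleton.1 hy
  obtain ⟨c, hc⟩ := hspan ⟨_, hyt⟩
  have hc : r • x = c • (s : R ⧸ Ideal.ofList rs) := by
    simpa using congrArg Subtype.val hc
  have := hx (algebraMap R _ r)
  rw [mul_comm, ← Algebra.smul_def, hc, map_smul, smul_eq_mul, mul_eq_zero] at this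
  rcases this with rfl | h
  · simp [hc] at hy0
  · exact hφ h

end Residue

/-- On a finite-dimensional Frobenius algebra, the first Koszul homology of two elements has twice
the dimension of the quotient by these elements. -/
theorem finrank_koszulHomologyOne {k R A : Type*} [Field k] [CommRing R] [Algebra k R]
    [CommRing A] [Algebra R A] [Algebra k A] [IsScalarTower k R A] [Module.Finite k A]
    (φ : A →ₗ[k] k) (hφ : ∀ x, (∀ y, φ (x * y) = 0) → x = 0) (a b : R) :
    Module.finrank k (KoszulHomologyOne a b A) =
      2 * Module.finrank k (A ⧸ LinearMap.range (koszulFst a b A)) := by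
  let d₁ := (koszulFst a b A).restrictScalars k
  let d₂ := (koszulSnd a b A).restrictScalars k
  let B : LinearMap.BilinForm k A := (LinearMap.mul k A).compr₂ φ
  have hB : B.Nondegenerate :=
    ⟨hφ, fun x hx ↦ hφ x fun y ↦ by rw [mul_comm]; exact hx y⟩
  have hle : LinearMap.range (koszulSnd a b A) ≤ LinearMap.ker (koszulFst a b A) := by
    rintro _ ⟨t, rfl⟩
    simp [smul_comm a b]
  have hker : LinearMap.ker d₂ = B.orthogonal (LinearMap.range d₁) := by
    ext x
    rw [LinearMap.BilinForm.mem_orthogonal_iff]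
    constructor
    · rintro hx _ ⟨⟨u, v⟩, rfl⟩
      have hx : (b • x, -(a • x)) = (0 : A × A) := hx
      have hb : b • x = 0 := congrArg Prod.fst hx
      have ha : a • x = 0 := neg_eq_zero.1 (congrArg Prod.snd hx)
      change φ ((a • u + b • v) * x) = 0
      rw [add_mul, smul_mul_assoc, smul_mul_assoc, ← mul_smul_comm, ← mul_smul_comm, ha, hb]
      simp
    · intro hx
      have ha : a • x = 0 := hφ _ fun y ↦ by
        have : φ ((a • y + b • 0) * x) = 0 := hx (d₁ (y, 0)) ⟨_, rfl⟩
        simpa [mul_comm] using this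
      have hb : b • x = 0 := hφ _ fun y ↦ by
        have : φ ((a • 0 + b • y) * x) = 0 := hx (d₁ (0, y)) ⟨_, rfl⟩
        simpa [mul_comm] using this
      change (b • x, -(a • x)) = (0 : A × A)
      rw [ha, hb, neg_zero, Prod.mk_zero_zero]
  have : Module.Finite k (LinearMap.ker (koszulFst a b A)) :=
    inferInstanceAs (Module.Finite k (LinearMap.ker d₁))
  let Z := (LinearMap.range (koszulSnd a b A)).submoduleOf (LinearMap.ker (koszulFst a b A))
  have h₁ := d₁.finrank_range_add_finrank_ker
  rw [Module.finrank_prod] at h₁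
  have h₂ := d₂.finrank_range_add_finrank_ker
  have h₃ := LinearMap.BilinForm.finrank_orthogonal hB (LinearMap.range d₁)
  rw [← hker] at h₃
  have h₄ := (LinearMap.range d₁).finrank_quotient_add_finrank
  have h₅ : Module.finrank k (_ ⧸ Z.restrictScalars k) + Module.finrank k Z =
      Module.finrank k (LinearMap.ker d₁) :=
    (Z.restrictScalars k).finrank_quotient_add_finrank
  have h₆ : Module.finrank k Z = Module.finrank k (LinearMap.range d₂) :=
    ((submoduleOfEquivOfLe hle).restrictScalars k).finrank_eq
  have h₇ : Module.finrank k (A ⧸ LinearMap.range d₁) =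
      Module.finrank k (A ⧸ LinearMap.range (koszulFst a b A)) :=
    (Quotient.restrictScalarsEquiv k (LinearMap.range (koszulFst a b A))).finrank_eq
  have h₈ : Module.finrank k (_ ⧸ Z.restrictScalars k) =
      Module.finrank k (KoszulHomologyOne a b A) :=
    (Quotient.restrictScalarsEquiv k Z).finrank_eq
  have h₉ := d₁.range.finrank_le
  omega

end Gorenstein

section PowerSeries

open Submodule RingTheory.Sequence IsLocalRing
open scoped Pointwise

/-- A regular sequence generating the maximal ideal is transported along a ring isomorphism. -/
theorem RingTheory.Sequence.IsRegular.map_ringEquiv_of_eq_maximalIdeal {R S : Type*} [CommRing R]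
    [CommRing S] [IsLocalRing R] [IsLocalRing S] {rs : List R} (h : IsRegular R rs) (e : R ≃+* S)
    (hmax : Ideal.ofList rs = maximalIdeal R) :
    IsRegular S (rs.map e) ∧ Ideal.ofList (rs.map e) = maximalIdeal S := by
  constructor
  · refine (AddEquiv.isRegular_congr (e := e.toAddEquiv) ?_).1 h
    exact List.forall₂_map_right_iff.mpr <| List.forall₂_same.mpr fun r _ x ↦ map_mul e r x
  · have := Ideal.map_ofList (e : R →+* S) rs
    rw [RingHom.coe_coe] at this
    rw [← this, hmax]
    have := Ideal.map_isMaximal_of_equiv e (p := maximalIdeal R)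
    exact eq_maximalIdeal this

theorem PowerSeries.isRegular_X_cons_map_C {S : Type*} [CommRing S] {rs : List S}
    (h : IsRegular S rs) : IsRegular (PowerSeries S) (X :: rs.map (C (R := S))) := by
  rw [isRegular_cons_iff]
  refine ⟨fun f g hfg ↦ X_mul_cancel hfg, ?_⟩
  have hmem : ∀ f : PowerSeries S,
      f ∈ ((X : PowerSeries S) • ⊤ : Submodule (PowerSeries S) (PowerSeries S)) ↔
        constantCoeff f = 0 := by
    intro f
    rw [← X_dvd_iff, mem_smul_pointwise_iff_exists]
    exact ⟨fun ⟨g, _, hg⟩ ↦ ⟨g, hg.symm⟩, fun ⟨g, hg⟩ ↦ ⟨g, trivial, hg.symm⟩⟩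
  let φ : QuotSMulTop (X : PowerSeries S) (PowerSeries S) →ₛₗ[constantCoeff (R := S)] S :=
    liftQ _ (constantCoeff (R := S)).toSemilinearMap fun f hf ↦ (hmem f).1 hf
  have hφ : Function.Bijective φ := by
    constructor
    · rw [← LinearMap.ker_eq_bot]
      exact ker_liftQ_eq_bot _ _ _ fun f hf ↦ (hmem f).2 hf
    · intro c
      exact ⟨mkQ _ (C c), constantCoeff_C c⟩
  refine (AddEquiv.isRegular_congr (e := AddEquiv.ofBijective φ hφ) ?_).2 h
  refine List.forall₂_map_left_iff.mpr <| List.forall₂_same.mpr fun r _ x ↦ ?_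
  change φ (C r • x) = r • φ x
  rw [map_smulₛₗ, constantCoeff_C]

theorem PowerSeries.ofList_X_cons_map_C {S : Type*} [CommRing S] [IsLocalRing S] {rs : List S}
    (h : Ideal.ofList rs = maximalIdeal S) :
    Ideal.ofList (X :: rs.map (C (R := S))) = maximalIdeal (PowerSeries S) := by
  have hmem : ∀ f : PowerSeries S, f ∈ maximalIdeal (PowerSeries S) ↔
      constantCoeff f ∈ maximalIdeal S := fun f ↦ by
    rw [mem_maximalIdeal, mem_maximalIdeal, mem_nonunits_iff, mem_nonunits_iff,
      isUnit_iff_constantCoeff]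
  rw [Ideal.ofList_cons, ← Ideal.map_ofList, h]
  refine le_antisymm (sup_le ?_ ?_) fun f hf ↦ ?_
  · rw [Ideal.span_singleton_le_iff_mem, hmem, constantCoeff_X]
    exact zero_mem _
  · rw [Ideal.map_le_iff_le_comap]
    intro c hc
    rwa [Ideal.mem_comap, hmem, constantCoeff_C]
  · rw [eq_X_mul_shift_add_const f]
    exact add_mem (mem_sup_left (Ideal.mul_mem_right _ _ (Ideal.mem_span_singleton_self _)))
      (mem_sup_right (Ideal.mem_map_of_mem _ ((hmem f).1 hf)))

theorem MvPowerSeries.exists_isRegular_ofList_eq_maximalIdeal (k : Type*) [Field k] (n : ℕ) :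
    ∃ xs : List (MvPowerSeries (Fin n) k), IsRegular (MvPowerSeries (Fin n) k) xs ∧
      Ideal.ofList xs = maximalIdeal (MvPowerSeries (Fin n) k) ∧ xs.length = n := by
  induction n with
  | zero =>
    have h0 : IsRegular k ([] : List k) := RingTheory.Sequence.IsRegular.nil _ _
    obtain ⟨h₁, h₂⟩ := h0.map_ringEquiv_of_eq_maximalIdeal
      (isEmptyEquiv (Fin 0) k).symm.toRingEquiv (by
      rw [Ideal.ofList_nil, eq_comm, ← IsLocalRing.isField_iff_maximalIdeal_eq]
      exact Field.toIsField k)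
    exact ⟨_, h₁, h₂, by simp⟩
  | succ n ih =>
    obtain ⟨xs, h, hmax, hlen⟩ := ih
    obtain ⟨h₁, h₂⟩ := (PowerSeries.isRegular_X_cons_map_C h).map_ringEquiv_of_eq_maximalIdeal
      (finSuccEquiv k n).symm.toRingEquiv (PowerSeries.ofList_X_cons_map_C hmax)
    exact ⟨_, h₁, h₂, by simp [hlen]⟩

theorem MvPowerSeries.surjective_algebraMap_residueField (σ k : Type*) [Field k] :
    Function.Surjective (algebraMap k (ResidueField (MvPowerSeries σ k))) := by
  intro x
  obtain ⟨f, rfl⟩ := residue_surjective x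
  refine ⟨constantCoeff f, ?_⟩
  change residue _ (C (constantCoeff f)) = residue _ f
  rw [← sub_eq_zero, ← map_sub, residue_eq_zero_iff, mem_maximalIdeal, mem_nonunits_iff,
    isUnit_iff_constantCoeff]
  simp

end PowerSeries

section Assembly

open Submodule RingTheory.Sequence

variable {R : Type*} [CommRing R]

theorem IsFiniteLength.koszulHomologyOne {X : Type*} [AddCommGroup X] [Module R X]
    (h : IsFiniteLength R X) (a b : R) : IsFiniteLength R (KoszulHomologyOne a b X) := by
  obtain ⟨_, _⟩ := isFiniteLength_iff_isNoetherian_isArtinian.1 h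
  exact isFiniteLength_iff_isNoetherian_isArtinian.2 ⟨inferInstance, inferInstance⟩

/-- `R ⧸ ((a, b) + J)` is the cokernel of the first Koszul differential on `R ⧸ J`. -/
theorem nonempty_quotient_span_pair_add_equiv (a b : R) (J : Ideal R) :
    Nonempty ((R ⧸ (Ideal.span {a, b} + J)) ≃ₗ[R]
      (R ⧸ J) ⧸ LinearMap.range (koszulFst a b (R ⧸ J))) := by
  refine LinearMap.nonempty_linearEquiv_of_ker_eq (mkQ_surjective _)
    (g := mkQ (LinearMap.range (koszulFst a b (R ⧸ J))) ∘ₗ mkQ J)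
    ((mkQ_surjective _).comp (mkQ_surjective _)) fun r ↦ ?_
  rw [LinearMap.comp_apply, mkQ_apply, mkQ_apply, Quotient.mk_eq_zero, Quotient.mk_eq_zero,
    Submodule.add_eq_sup, mem_sup]
  constructor
  · rintro ⟨y, hy, z, hz, rfl⟩
    obtain ⟨p, q, rfl⟩ := Ideal.mem_span_pair.1 hy
    refine ⟨(mkQ J p, mkQ J q), ?_⟩
    rw [koszulFst_apply, ← map_smul, ← map_smul, ← map_add, ← sub_eq_zero, ← map_sub, mkQ_apply,
      Quotient.mk_eq_zero, ← neg_mem_iff]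
    simpa [mul_comm] using hz
  · rintro ⟨⟨u, v⟩, h⟩
    obtain ⟨p, rfl⟩ := mkQ_surjective J u
    obtain ⟨q, rfl⟩ := mkQ_surjective J v
    rw [koszulFst_apply, ← map_smul, ← map_smul, ← map_add, ← sub_eq_zero, ← map_sub, mkQ_apply,
      Quotient.mk_eq_zero, ← neg_mem_iff, neg_sub] at h
    exact ⟨_, Ideal.mem_span_pair.2 ⟨p, q, rfl⟩, _, h, by simp [mul_comm]⟩

theorem RestrictScalars.finrank_eq_of_linearEquiv {k M N : Type*} [CommRing k] [Algebra k R]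
    [AddCommGroup M] [Module R M] [AddCommGroup N] [Module R N] [Module k N] [IsScalarTower k R N]
    (e : M ≃ₗ[R] N) : Module.finrank k (RestrictScalars k R M) = Module.finrank k N := by
  let e' : RestrictScalars k R M ≃ₗ[k] N :=
    { (RestrictScalars.addEquiv k R M).trans e.toAddEquiv with
      map_smul' := fun c x ↦ by
        change e (RestrictScalars.addEquiv k R M (c • x)) =
          c • e (RestrictScalars.addEquiv k R M x)
        rw [RestrictScalars.addEquiv_map_smul, map_smul, algebraMap_smul] }
  exact e'.finrank_eq

end Assembly

/-- **Proposition (dimension of Tor₁).**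
Let `R = ℂ⟦x₁,…,xₙ⟧` with `n ≥ 2`. If `I ⊆ R` is generated by a regular
sequence of length `2` and `J ⊆ R` is generated by a regular sequence of
length `n`, then `Tor₁^R(R/I, R/J)` has finite length and its length
(equivalently, its dimension as a `ℂ`-vector space) equals
`2 · length_R (R/(I+J))`. -/
theorem tor_length_of_regular_seq_two (n : ℕ) (hn : 2 ≤ n)
    (a b : MvPowerSeries (Fin n) ℂ)
    (hab : RingTheory.Sequence.IsRegular (MvPowerSeries (Fin n) ℂ) [a, b])
    (rs : List (MvPowerSeries (Fin n) ℂ)) (hlen : rs.length = n)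
    (hrs : RingTheory.Sequence.IsRegular (MvPowerSeries (Fin n) ℂ) rs)
    (I J : Ideal (MvPowerSeries (Fin n) ℂ))
    (hI : I = Ideal.span {a, b}) (hJ : J = Ideal.ofList rs) :
    IsFiniteLength (MvPowerSeries (Fin n) ℂ)
      (((Tor (ModuleCat (MvPowerSeries (Fin n) ℂ)) 1).obj
          (ModuleCat.of (MvPowerSeries (Fin n) ℂ) (MvPowerSeries (Fin n) ℂ ⧸ I))).obj
        (ModuleCat.of (MvPowerSeries (Fin n) ℂ) (MvPowerSeries (Fin n) ℂ ⧸ J))) ∧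
    Module.finrank ℂ
      (RestrictScalars ℂ (MvPowerSeries (Fin n) ℂ)
        (((Tor (ModuleCat (MvPowerSeries (Fin n) ℂ)) 1).obj
            (ModuleCat.of (MvPowerSeries (Fin n) ℂ) (MvPowerSeries (Fin n) ℂ ⧸ I))).obj
          (ModuleCat.of (MvPowerSeries (Fin n) ℂ) (MvPowerSeries (Fin n) ℂ ⧸ J)))) =
    2 * Module.finrank ℂ
      (RestrictScalars ℂ (MvPowerSeries (Fin n) ℂ)
        (MvPowerSeries (Fin n) ℂ ⧸ (I + J))) := by
  subst hI hJ
  obtain ⟨xs, hxs, hmax, hxlen⟩ := MvPowerSeries.exists_isRegular_ofList_eq_maximalIdeal ℂ n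
  have hk := MvPowerSeries.surjective_algebraMap_residueField (Fin n) ℂ
  have hlen' := hlen.trans hxlen.symm
  have := hrs.isArtinianRing_quotient_of_length_eq hxs hmax hlen'
  have hA : IsFiniteLength (MvPowerSeries (Fin n) ℂ)
      (MvPowerSeries (Fin n) ℂ ⧸ Ideal.ofList rs) :=
    isFiniteLength_iff_isNoetherian_isArtinian.2 ⟨inferInstance,
      isArtinian_of_surjective_algebraMap
        (Ideal.Quotient.mk_surjective (I := Ideal.ofList rs))⟩
  have := hA.module_finite_of_residueField hk
  obtain ⟨φ, hφ⟩ := exists_dual_mul_nondegenerate hk hrs hxs hmax hlen'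
  obtain ⟨e⟩ := nonempty_tor_one_equiv_koszulHomologyOne hab.toIsWeaklyRegular
    (MvPowerSeries (Fin n) ℂ ⧸ Ideal.ofList rs)
  obtain ⟨e'⟩ := nonempty_quotient_span_pair_add_equiv a b (Ideal.ofList rs)
  refine ⟨(hA.koszulHomologyOne a b).of_injective e.injective, ?_⟩
  rw [RestrictScalars.finrank_eq_of_linearEquiv e, RestrictScalars.finrank_eq_of_linearEquiv e']
  exact finrank_koszulHomologyOne φ hφ a b
end

section
/- Let R = ℂ⟦x₁,…,xₙ⟧, let 1 ≤ k ≤ n, let A be a k×n matrix with entries in R, and let I_k(A) ⊆ R be the ideal generated by all k×k minors of A. Assume the Krull dimension of R/I_k(A) equals k−1, and let M = R^k / A(Rⁿ) be the cokernel of the R-linear map Rⁿ → R^k determined by A. If g₁, …, g_{k−1} ∈ R are elements such that R/((g₁,…,g_{k−1}) + I_k(A)) has Krull dimension 0, then g₁, …, g_{k−1} is an M-regular sequence. -/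
section

open IsLocalRing Module
open scoped Pointwise

universe u v w

section Dimension

variable {S : Type u} [CommRing S]

/-- The Krull dimension of a subset of the prime spectrum. -/
noncomputable def zdim (Z : Set (PrimeSpectrum S)) : WithBot ℕ∞ := Order.krullDim Z

lemma supportDim_eq_zdim (M : Type v) [AddCommGroup M] [Module S M] :
    supportDim S M = zdim (support S M) := rfl

lemma zdim_mono {Z W : Set (PrimeSpectrum S)} (h : Z ⊆ W) : zdim Z ≤ zdim W :=
  Order.krullDim_le_of_strictMono (Set.inclusion h) fun _ _ hab => hab

lemma zdim_zeroLocus (I : Ideal S) :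
    zdim (PrimeSpectrum.zeroLocus (I : Set S)) = ringKrullDim (S ⧸ I) :=
  (ringKrullDim_quotient I).symm

lemma zdim_union_le {Z W : Set (PrimeSpectrum S)} (hZ : IsClosed Z) (hW : IsClosed W) {d : ℕ}
    (h₁ : zdim Z ≤ d) (h₂ : zdim W ≤ d) : zdim (Z ∪ W) ≤ d := by
  have key : ∀ Y : Set (PrimeSpectrum S), IsClosed Y → zdim Y ≤ d →
      ∀ p : LTSeries ↥(Z ∪ W), (p.head : PrimeSpectrum S) ∈ Y → p.length ≤ d := by
    intro Y hY hd p hp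
    have hmem : ∀ i, ((p i : ↥(Z ∪ W)) : PrimeSpectrum S) ∈ Y := by
      intro i
      have hle : (p.head : PrimeSpectrum S) ≤ p i := p.head_le i
      exact ((PrimeSpectrum.le_iff_specializes _ _).1 hle).mem_closed hY hp
    let q : LTSeries Y :=
      { length := p.length
        toFun := fun i => ⟨p i, hmem i⟩
        step := fun i => p.step i }
    have := (Order.LTSeries.length_le_krullDim q).trans hd
    exact_mod_cast this
  refine iSup_le fun p => ?_
  rcases p.head.2 with h | h
  · exact_mod_cast key Z hZ h₁ p h
  · exact_mod_cast key W hW h₂ p h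

variable [IsNoetherianRing S] [IsLocalRing S]

lemma zdim_le_inter_zeroLocus_succ {Z : Set (PrimeSpectrum S)} (hZ : IsClosed Z) {x : S}
    (hx : x ∈ maximalIdeal S) :
    zdim Z ≤ zdim (Z ∩ PrimeSpectrum.zeroLocus {x}) + 1 := by
  obtain ⟨I, rfl⟩ := (PrimeSpectrum.isClosed_iff_zeroLocus_ideal Z).1 hZ
  have h := supportDim_le_supportDim_quotSMulTop_succ (M := S ⧸ I) hx
  rw [supportDim_eq_zdim, supportDim_eq_zdim, support_quotSMulTop, support_eq_zeroLocus,
    Ideal.annihilator_quotient] at h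
  exact h

lemma zdim_le_inter_zeroLocus_list_add {Z : Set (PrimeSpectrum S)} (hZ : IsClosed Z) (l : List S)
    (hl : ∀ x ∈ l, x ∈ maximalIdeal S) {d : ℕ}
    (h : zdim (Z ∩ PrimeSpectrum.zeroLocus {x | x ∈ l}) ≤ d) :
    zdim Z ≤ (d + l.length : ℕ) := by
  induction l generalizing Z with
  | nil => simpa using h
  | cons x l ih =>
    have h1 := ih (Z := Z ∩ PrimeSpectrum.zeroLocus {x})
      (hZ.inter (PrimeSpectrum.isClosed_zeroLocus _)) (fun y hy => hl y (by simp [hy])) (by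
        have hs : {y | y ∈ x :: l} = {x} ∪ {y | y ∈ l} := by ext; simp
        rw [hs, PrimeSpectrum.zeroLocus_union] at h
        rwa [Set.inter_assoc])
    have h2 := zdim_le_inter_zeroLocus_succ hZ (hl x (by simp))
    refine h2.trans ((add_le_add_left h1 1).trans ?_)
    rw [List.length_cons]
    push_cast
    rw [add_assoc]

end Dimension

/-- A module is Cohen–Macaulay of dimension `d` (or zero) if its support has dimension at most `d`
and every element of the maximal ideal which lowers the dimension is regular with Cohen–Macaulay
quotient of dimension `d - 1`. -/
def IsCM (S : Type u) [CommRing S] [IsLocalRing S] :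
    ℕ → (M : Type v) → [AddCommGroup M] → [Module S M] → Prop
  | 0, M, _, _ => supportDim S M ≤ 0
  | d + 1, M, _, _ => supportDim S M ≤ (d + 1 : ℕ) ∧
      ∀ x ∈ maximalIdeal S, supportDim S (QuotSMulTop x M) ≤ d →
        IsSMulRegular M x ∧ IsCM S d (QuotSMulTop x M)

namespace IsCM

section Congr

variable {S : Type u} {R : Type w} [CommRing S] [CommRing R]

lemma _root_.supportDim_eq_of_semilinear (σ : S →+* R) (hσ : Function.Surjective σ)
    {M N : Type*} [AddCommGroup M] [AddCommGroup N] [Module S M] [Module R N]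
    [Module.Finite S M] [Module.Finite R N]
    (e : M ≃+ N) (he : ∀ s m, e (s • m) = σ s • e m) : supportDim S M = supportDim R N := by
  rw [supportDim_eq_ringKrullDim_quotient_annihilator,
    supportDim_eq_ringKrullDim_quotient_annihilator]
  have hker : annihilator S M = RingHom.ker ((Ideal.Quotient.mk (annihilator R N)).comp σ) := by
    ext s
    rw [RingHom.mem_ker, RingHom.comp_apply, Ideal.Quotient.eq_zero_iff_mem, mem_annihilator,
      mem_annihilator]
    constructor
    · intro h n
      obtain ⟨m, rfl⟩ := e.surjective n
      rw [← he, h, map_zero]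
    · intro h m
      apply e.injective
      rw [he, h, map_zero]
  rw [hker]
  exact ringKrullDim_eq_of_ringEquiv (RingHom.quotientKerEquivOfSurjective
    (Ideal.Quotient.mk_surjective.comp hσ))

lemma _root_.isSMulRegular_of_semilinear (σ : S →+* R)
    {M N : Type*} [AddCommGroup M] [AddCommGroup N] [Module S M] [Module R N]
    (e : M ≃+ N) (he : ∀ s m, e (s • m) = σ s • e m) (x : S) :
    IsSMulRegular M x ↔ IsSMulRegular N (σ x) := by
  rw [isSMulRegular_iff_right_eq_zero_of_smul, isSMulRegular_iff_right_eq_zero_of_smul]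
  constructor
  · intro h n hn
    obtain ⟨m, rfl⟩ := e.surjective n
    rw [← he, e.map_eq_zero_iff] at hn
    rw [h m hn, map_zero]
  · intro h m hm
    rw [← e.map_eq_zero_iff] at hm ⊢
    rw [he] at hm
    exact h _ hm

lemma _root_.exists_quotSMulTop_semilinear (σ : S →+* R)
    {M N : Type*} [AddCommGroup M] [AddCommGroup N] [Module S M] [Module R N]
    (e : M ≃+ N) (he : ∀ s m, e (s • m) = σ s • e m) (x : S) :
    ∃ e' : QuotSMulTop x M ≃+ QuotSMulTop (σ x) N, ∀ s m, e' (s • m) = σ s • e' m := by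
  let f : M →ₛₗ[σ] N := { toFun := e, map_add' := e.map_add, map_smul' := he }
  have hf : ∀ m, f m = e m := fun _ => rfl
  have hle : x • (⊤ : Submodule S M) ≤ (σ x • (⊤ : Submodule R N)).comap f := by
    intro m hm
    obtain ⟨m', -, rfl⟩ := (Submodule.mem_smul_pointwise_iff_exists _ _ _).1 hm
    rw [Submodule.mem_comap, map_smulₛₗ]
    exact Submodule.smul_mem_pointwise_smul _ _ _ trivial
  let F := Submodule.mapQ _ _ f hle
  have hF : ∀ m : M, F (Submodule.Quotient.mk m) = Submodule.Quotient.mk (f m) := fun _ => rfl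
  have hb : Function.Bijective F := by
    constructor
    · refine (injective_iff_map_eq_zero F).2 fun m hm => ?_
      obtain ⟨m, rfl⟩ := Submodule.Quotient.mk_surjective _ m
      rw [hF, Submodule.Quotient.mk_eq_zero] at hm
      obtain ⟨n, -, hn⟩ := (Submodule.mem_smul_pointwise_iff_exists _ _ _).1 hm
      obtain ⟨m', rfl⟩ := e.surjective n
      rw [Submodule.Quotient.mk_eq_zero]
      rw [hf, ← he] at hn
      rw [← e.injective hn]
      exact Submodule.smul_mem_pointwise_smul _ _ _ trivial
    · intro n
      obtain ⟨n, rfl⟩ := Submodule.Quotient.mk_surjective _ n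
      obtain ⟨m, rfl⟩ := e.surjective n
      exact ⟨Submodule.Quotient.mk m, rfl⟩
  exact ⟨AddEquiv.ofBijective F hb, fun s m => F.map_smulₛₗ s m⟩

variable [IsLocalRing S] [IsLocalRing R]

/-- The Cohen–Macaulay property does not depend on the base ring, as long as the change of rings
is surjective. -/
theorem congr_semilinear (σ : S →+* R) (hσ : Function.Surjective σ) (d : ℕ)
    {M : Type*} {N : Type*} [AddCommGroup M] [AddCommGroup N] [Module S M] [Module R N]
    [Module.Finite S M] [Module.Finite R N]
    (e : M ≃+ N) (he : ∀ s m, e (s • m) = σ s • e m) : IsCM S d M ↔ IsCM R d N := by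
  induction d generalizing M N with
  | zero => rw [IsCM, IsCM, supportDim_eq_of_semilinear σ hσ e he]
  | succ d ih =>
    rw [IsCM, IsCM, supportDim_eq_of_semilinear σ hσ e he]
    have : IsLocalHom σ := .of_surjective σ hσ
    have key : ∀ x : S, (supportDim S (QuotSMulTop x M) ≤ d →
        IsSMulRegular M x ∧ IsCM S d (QuotSMulTop x M)) ↔
        (supportDim R (QuotSMulTop (σ x) N) ≤ d →
        IsSMulRegular N (σ x) ∧ IsCM R d (QuotSMulTop (σ x) N)) := by
      intro x
      obtain ⟨e', he'⟩ := exists_quotSMulTop_semilinear σ e he x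
      rw [supportDim_eq_of_semilinear σ hσ e' he', isSMulRegular_of_semilinear σ e he, ih e' he']
    refine and_congr_right fun _ => ⟨fun h y hy => ?_, fun h x hx => ?_⟩
    · obtain ⟨x, rfl⟩ := hσ y
      refine (key x).1 (h x ?_)
      rw [mem_maximalIdeal, mem_nonunits_iff] at hy ⊢
      exact fun hu => hy (hu.map σ)
    · refine (key x).2 (h _ ?_)
      rw [mem_maximalIdeal, mem_nonunits_iff] at hx ⊢
      exact fun hu => hx (isUnit_of_map_unit σ x hu)

lemma congr {d : ℕ} {M N : Type*} [AddCommGroup M] [AddCommGroup N] [Module S M] [Module S N]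
    [Module.Finite S M] [Module.Finite S N] (e : M ≃ₗ[S] N) (h : IsCM S d M) : IsCM S d N :=
  (congr_semilinear (RingHom.id S) Function.surjective_id d e.toAddEquiv (by simp)).1 h

end Congr

end IsCM

lemma WithBot.le_natCast_of_add_one_le {a : WithBot ℕ∞} {d : ℕ} (h : a + 1 ≤ (d + 1 : ℕ)) :
    a ≤ d := by
  induction a with
  | bot => exact bot_le
  | coe a =>
    have h2 : a + 1 ≤ (d : ℕ∞) + 1 := by exact_mod_cast h
    exact_mod_cast (ENat.add_le_add_iff_right (by simp)).1 h2

section Parameters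

variable {S : Type u} [CommRing S] [IsNoetherianRing S] [IsLocalRing S]

omit [IsNoetherianRing S] in
lemma supportDim_quotSMulTop_le {M : Type*} [AddCommGroup M] [Module S M] [Module.Finite S M]
    {x : S} {d : ℕ}
    (hx : ∀ p ∈ (annihilator S M).minimalPrimes, p ≠ maximalIdeal S → x ∉ p)
    (hM : supportDim S M ≤ (d + 1 : ℕ)) : supportDim S (QuotSMulTop x M) ≤ d := by
  by_cases hm : maximalIdeal S ∈ (annihilator S M).minimalPrimes
  · have h0 : supportDim S M ≤ 0 := by
      rw [supportDim_eq_zdim]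
      have : support S M ⊆ {closedPoint S} := by
        intro p hp
        rw [mem_support_iff_of_finite] at hp
        rw [Set.mem_singleton_iff, PrimeSpectrum.ext_iff]
        exact le_antisymm (le_maximalIdeal p.2.ne_top)
          (hm.2 ⟨p.2, hp⟩ (le_maximalIdeal p.2.ne_top))
      refine (zdim_mono this).trans ?_
      exact Order.krullDim_nonpos_of_subsingleton
    refine (supportDim_le_of_surjective (N := QuotSMulTop x M) (Submodule.mkQ _)
      (Submodule.mkQ_surjective _)).trans (h0.trans ?_)
    exact_mod_cast Nat.zero_le d
  · have h1 := supportDim_quotSMulTop_succ_le_of_notMem_minimalPrimes (M := M) (x := x)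
      fun p hp => hx p hp (by rintro rfl; exact hm hp)
    exact WithBot.le_natCast_of_add_one_le (h1.trans hM)

omit [IsNoetherianRing S] in
lemma exists_mem_maximalIdeal_forall_notMem {s : Set (Ideal S)} (hs : s.Finite)
    (hp : ∀ p ∈ s, p.IsPrime) : ∃ x ∈ maximalIdeal S, ∀ p ∈ s, p ≠ maximalIdeal S → x ∉ p := by
  by_contra! h
  have h1 : (maximalIdeal S : Set S) ⊆ ⋃ p ∈ s \ {maximalIdeal S}, ((id p : Ideal S) : Set S) := by
    intro x hx
    obtain ⟨p, hp, hne, hxp⟩ := h x hx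
    simp only [Set.mem_iUnion]
    exact ⟨p, ⟨hp, hne⟩, hxp⟩
  obtain ⟨p, hps, hle⟩ := (Ideal.subset_union_prime_finite (hs.subset Set.sdiff_subset) ⊤ ⊤
    (fun p h _ _ => hp p h.1)).1 h1
  exact hps.2 ((le_maximalIdeal (hp p hps.1).ne_top).antisymm hle)

lemma exists_parameter₃ (M₁ M₂ M₃ : Type*) [AddCommGroup M₁] [Module S M₁] [Module.Finite S M₁]
    [AddCommGroup M₂] [Module S M₂] [Module.Finite S M₂]
    [AddCommGroup M₃] [Module S M₃] [Module.Finite S M₃] :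
    ∃ x ∈ maximalIdeal S,
      (∀ d : ℕ, supportDim S M₁ ≤ (d + 1 : ℕ) → supportDim S (QuotSMulTop x M₁) ≤ d) ∧
      (∀ d : ℕ, supportDim S M₂ ≤ (d + 1 : ℕ) → supportDim S (QuotSMulTop x M₂) ≤ d) ∧
      (∀ d : ℕ, supportDim S M₃ ≤ (d + 1 : ℕ) → supportDim S (QuotSMulTop x M₃) ≤ d) := by
  obtain ⟨x, hx, h⟩ := exists_mem_maximalIdeal_forall_notMem
    (((Ideal.finite_minimalPrimes_of_isNoetherianRing S (annihilator S M₁)).union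
      (Ideal.finite_minimalPrimes_of_isNoetherianRing S (annihilator S M₂))).union
      (Ideal.finite_minimalPrimes_of_isNoetherianRing S (annihilator S M₃)))
    (by rintro p ((hp | hp) | hp) <;> exact hp.1.1)
  exact ⟨x, hx, fun d => supportDim_quotSMulTop_le fun p hp => h p (.inl (.inl hp)),
    fun d => supportDim_quotSMulTop_le fun p hp => h p (.inl (.inr hp)),
    fun d => supportDim_quotSMulTop_le fun p hp => h p (.inr hp)⟩

lemma supportDim_le_of_isSMulRegular {N : Type*} [AddCommGroup N] [Module S N] [Module.Finite S N]
    {x : S} (hx : x ∈ maximalIdeal S) (hreg : IsSMulRegular N x) {d : ℕ}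
    (hd : supportDim S N ≤ (d + 1 : ℕ)) : supportDim S (QuotSMulTop x N) ≤ d := by
  rw [← supportDim_quotSMulTop_succ_eq_supportDim hreg hx] at hd
  exact WithBot.le_natCast_of_add_one_le hd

lemma supportDim_le_succ {N : Type*} [AddCommGroup N] [Module S N] [Module.Finite S N]
    {x : S} (hx : x ∈ maximalIdeal S) {d : ℕ}
    (hd : supportDim S (QuotSMulTop x N) ≤ d) : supportDim S N ≤ (d + 1 : ℕ) := by
  refine (supportDim_le_supportDim_quotSMulTop_succ hx).trans ?_
  push_cast
  gcongr

lemma subsingleton_of_isSMulRegular {N : Type*} [AddCommGroup N] [Module S N] [Module.Finite S N]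
    {x : S} (hx : x ∈ maximalIdeal S) (hreg : IsSMulRegular N x)
    (hd : supportDim S N ≤ 0) : Subsingleton N := by
  rw [← supportDim_eq_bot_iff_subsingleton S]
  rw [← supportDim_quotSMulTop_succ_eq_supportDim hreg hx] at hd ⊢
  have : supportDim S (QuotSMulTop x N) = ⊥ := by
    generalize supportDim S (QuotSMulTop x N) = a at hd
    induction a with
    | bot => rfl
    | coe a =>
      exfalso
      have h2 : ((a + 1 : ℕ∞) : WithBot ℕ∞) ≤ ((0 : ℕ∞) : WithBot ℕ∞) := by exact_mod_cast hd
      simp at h2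
  rw [this]; rfl

omit [IsNoetherianRing S] in
lemma subsingleton_of_quotSMulTop {N : Type*} [AddCommGroup N] [Module S N] [Module.Finite S N]
    {x : S} (hx : x ∈ maximalIdeal S) (h : Subsingleton (QuotSMulTop x N)) : Subsingleton N := by
  by_contra hN
  rw [not_subsingleton_iff_nontrivial] at hN
  exact not_subsingleton_iff_nontrivial.2 (nontrivial_quotSMulTop_of_mem_maximalIdeal N hx) h

end Parameters

section QuotSMulTop

variable {S : Type u} [CommRing S] {M N : Type*} [AddCommGroup M] [Module S M]
  [AddCommGroup N] [Module S N]

/-- Reductions modulo two elements commute. -/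
noncomputable def quotSMulTopSwap (x y : S) (M : Type*) [AddCommGroup M] [Module S M] :
    QuotSMulTop x (QuotSMulTop y M) ≃ₗ[S] QuotSMulTop y (QuotSMulTop x M) :=
  QuotSMulTop.equivQuotTensor x _ ≪≫ₗ
    TensorProduct.congr (.refl S _) (QuotSMulTop.equivQuotTensor y M) ≪≫ₗ
    TensorProduct.leftComm S _ _ _ ≪≫ₗ
    TensorProduct.congr (.refl S _) (QuotSMulTop.equivQuotTensor x M).symm ≪≫ₗ
    (QuotSMulTop.equivQuotTensor y _).symm

lemma quotSMulTop_mk_eq_zero {x : S} {m : M} :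
    (Submodule.Quotient.mk m : QuotSMulTop x M) = 0 ↔ ∃ m', m = x • m' := by
  rw [Submodule.Quotient.mk_eq_zero, Submodule.mem_smul_pointwise_iff_exists]
  simp [eq_comm]

lemma quotSMulTop_map_injective {x : S} {f : N →ₗ[S] M} (hf : Function.Injective f)
    (h : ∀ m n, f n = x • m → ∃ n', m = f n') :
    Function.Injective (QuotSMulTop.map x f) := by
  refine (injective_iff_map_eq_zero _).2 fun n hn => ?_
  obtain ⟨n, rfl⟩ := Submodule.Quotient.mk_surjective _ n
  rw [QuotSMulTop.map_apply_mk, quotSMulTop_mk_eq_zero] at hn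
  obtain ⟨m, hm⟩ := hn
  obtain ⟨n', rfl⟩ := h _ _ hm
  rw [quotSMulTop_mk_eq_zero]
  exact ⟨n', hf (by rw [hm, map_smul])⟩

lemma isSMulRegular_of_injective {x : S} {f : N →ₗ[S] M} (hf : Function.Injective f)
    (h : IsSMulRegular M x) : IsSMulRegular N x := by
  rw [isSMulRegular_iff_right_eq_zero_of_smul] at h ⊢
  intro n hn
  exact hf (by rw [h (f n) (by rw [← map_smul, hn, map_zero]), map_zero])

lemma isSMulRegular_swap [IsLocalRing S] [IsNoetherianRing S] [Module.Finite S M] {x y : S}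
    (hx : x ∈ maximalIdeal S) (hy : y ∈ maximalIdeal S) (hxM : IsSMulRegular M x)
    (hyM : IsSMulRegular (QuotSMulTop x M) y) :
    IsSMulRegular M y ∧ IsSMulRegular (QuotSMulTop y M) x := by
  have h : RingTheory.Sequence.IsWeaklyRegular M [x, y] := by
    simp [RingTheory.Sequence.isWeaklyRegular_cons_iff, hxM, hyM]
  have h2 := isWeaklyRegular_of_perm_of_subset_maximalIdeal h (List.Perm.swap y x []) (by
    intro r hr
    simp only [List.mem_cons, List.not_mem_nil, or_false] at hr
    rcases hr with rfl | rfl <;> assumption)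
  simpa [RingTheory.Sequence.isWeaklyRegular_cons_iff] using h2

lemma supportDim_le_quotSMulTop_of_injective [Module.Finite S M] {x : S} {f : N →ₗ[S] M}
    (hf : Function.Injective f) (h : ∀ n : N, x • n = 0) :
    supportDim S N ≤ supportDim S (QuotSMulTop x M) := by
  rw [supportDim_eq_zdim, supportDim_eq_zdim, support_quotSMulTop]
  refine zdim_mono (Set.subset_inter (support_subset_of_injective f hf) ?_)
  intro p hp
  rw [PrimeSpectrum.mem_zeroLocus, Set.singleton_subset_iff]
  exact annihilator_le_of_mem_support hp (mem_annihilator.2 h)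

end QuotSMulTop

namespace IsCM

variable {S : Type u} [CommRing S] [IsNoetherianRing S] [IsLocalRing S]

omit [IsNoetherianRing S] in
lemma supportDim_le {d : ℕ} {M : Type v} [AddCommGroup M] [Module S M] (h : IsCM S d M) :
    supportDim S M ≤ d := by
  cases d with
  | zero => simpa [IsCM] using h
  | succ d => exact h.1

omit [IsNoetherianRing S] in
lemma isSMulRegular {d : ℕ} {M : Type v} [AddCommGroup M] [Module S M] (h : IsCM S (d + 1) M)
    {x : S} (hx : x ∈ maximalIdeal S) (hd : supportDim S (QuotSMulTop x M) ≤ d) :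
    IsSMulRegular M x := (h.2 x hx hd).1

omit [IsNoetherianRing S] in
lemma quotSMulTop {d : ℕ} {M : Type v} [AddCommGroup M] [Module S M] (h : IsCM S (d + 1) M)
    {x : S} (hx : x ∈ maximalIdeal S) (hd : supportDim S (QuotSMulTop x M) ≤ d) :
    IsCM S d (QuotSMulTop x M) := (h.2 x hx hd).2

omit [IsNoetherianRing S] in
lemma of_subsingleton (d : ℕ) (M : Type v) [AddCommGroup M] [Module S M] [Subsingleton M] :
    IsCM S d M := by
  induction d generalizing M with
  | zero => rw [IsCM, supportDim_eq_bot_of_subsingleton]; exact bot_le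
  | succ d ih =>
    refine ⟨?_, fun x _ _ => ⟨fun a b _ => Subsingleton.elim a b, ?_⟩⟩
    · rw [supportDim_eq_bot_of_subsingleton]; exact bot_le
    · have : Subsingleton (QuotSMulTop x M) := (Submodule.mkQ_surjective _).subsingleton
      exact ih _

/-- A Cohen–Macaulay module has no nonzero submodules of smaller dimension. -/
theorem subsingleton_of_injective {d : ℕ} {M N : Type v} [AddCommGroup M] [Module S M]
    [Module.Finite S M] [AddCommGroup N] [Module S N] (hM : IsCM S (d + 1) M)
    (f : N →ₗ[S] M) (hf : Function.Injective f) (hN : supportDim S N ≤ d) : Subsingleton N := by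
  induction d generalizing M N with
  | zero =>
    have : Module.Finite S N := .of_injective f hf
    obtain ⟨z, hz, hz', -⟩ := exists_parameter₃ M M M (S := S)
    have hreg := hM.isSMulRegular hz (hz' _ hM.supportDim_le)
    exact subsingleton_of_isSMulRegular hz (isSMulRegular_of_injective hf hreg) hN
  | succ d ih =>
    obtain ⟨z, hz, hz', -⟩ := exists_parameter₃ M M M (S := S)
    have hzd := hz' _ hM.supportDim_le
    have hreg := hM.isSMulRegular hz hzd
    obtain ⟨P, ⟨hPN, hPd⟩, hmax⟩ := set_has_maximal_iff_noetherian.2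
      (inferInstance : IsNoetherian S M)
      {P | LinearMap.range f ≤ P ∧ supportDim S P ≤ (d + 1 : ℕ)}
      ⟨LinearMap.range f, le_rfl, by
        rwa [← supportDim_eq_of_equiv (LinearEquiv.ofInjective f hf)]⟩
    have hsat : ∀ m, z • m ∈ P → m ∈ P := by
      let Q := P.comap (LinearMap.lsmul S M z)
      have hPQ : P ≤ Q := fun m hm => P.smul_mem z hm
      have hQ : supportDim S Q ≤ (d + 1 : ℕ) := by
        let F : Q →ₗ[S] P := (LinearMap.lsmul S M z).restrict fun m hm => hm
        refine (supportDim_le_of_injective F ?_).trans hPd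
        intro a b hab
        exact Subtype.ext (hreg (congrArg Subtype.val hab))
      have hnot := hmax Q ⟨hPN.trans hPQ, hQ⟩
      intro m hm
      by_contra hmP
      exact hnot (lt_of_le_of_ne hPQ fun h => hmP (by rw [h]; exact hm))
    have hinj : Function.Injective (QuotSMulTop.map z P.subtype) :=
      quotSMulTop_map_injective P.subtype_injective fun m n h =>
        ⟨⟨m, hsat m (by rw [← h]; exact n.2)⟩, rfl⟩
    have hfin : Module.Finite S P := .of_injective P.subtype P.subtype_injective
    have h1 := ih (hM.quotSMulTop hz hzd) _ hinj
      (supportDim_le_of_isSMulRegular hz (isSMulRegular_of_injective P.subtype_injective hreg) hPd)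
    have h2 : Subsingleton P := subsingleton_of_quotSMulTop hz h1
    refine ⟨fun a b => hf ?_⟩
    exact congrArg Subtype.val (Subsingleton.elim (⟨f a, hPN ⟨a, rfl⟩⟩ : P) ⟨f b, hPN ⟨b, rfl⟩⟩)

lemma isSMulRegular_of_quotSMulTop {d : ℕ} {M : Type v} [AddCommGroup M] [Module S M]
    [Module.Finite S M] {x y : S} (hx : x ∈ maximalIdeal S) (hxM : IsSMulRegular M x)
    (h : IsCM S d (QuotSMulTop x M))
    (hyd : supportDim S (QuotSMulTop y M) ≤ d) : IsSMulRegular M y := by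
  let K := LinearMap.ker (LinearMap.lsmul S M y)
  have hK : ∀ m, m ∈ K ↔ y • m = 0 := fun m => LinearMap.mem_ker
  have hxK : IsSMulRegular K x := isSMulRegular_of_injective K.subtype_injective hxM
  have hKd : supportDim S K ≤ d := (supportDim_le_quotSMulTop_of_injective K.subtype_injective
    fun n => Subtype.ext ((hK _).1 n.2)).trans hyd
  have hinj : Function.Injective (QuotSMulTop.map x K.subtype) :=
    quotSMulTop_map_injective K.subtype_injective fun m n h => by
      refine ⟨⟨m, (hK m).2 (isSMulRegular_iff_right_eq_zero_of_smul.1 hxM _ ?_)⟩, rfl⟩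
      rw [smul_comm, ← h]
      exact (hK _).1 n.2
  have hsub : Subsingleton K := by
    cases d with
    | zero => exact subsingleton_of_isSMulRegular hx hxK hKd
    | succ d =>
      exact subsingleton_of_quotSMulTop hx (h.subsingleton_of_injective _ hinj
        (supportDim_le_of_isSMulRegular hx hxK hKd))
  rw [isSMulRegular_iff_right_eq_zero_of_smul]
  intro m hm
  exact congrArg Subtype.val (Subsingleton.elim (⟨m, (hK m).2 hm⟩ : K) 0)

/-- If `x` is regular on `M` and `M / xM` is Cohen–Macaulay, so is `M`. -/
theorem of_quotSMulTop {d : ℕ} {M : Type v} [AddCommGroup M] [Module S M]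
    [Module.Finite S M] {x : S} (hx : x ∈ maximalIdeal S) (hxM : IsSMulRegular M x)
    (h : IsCM S d (QuotSMulTop x M)) : IsCM S (d + 1) M := by
  induction d generalizing M x with
  | zero =>
    exact ⟨supportDim_le_succ hx h.supportDim_le, fun y hy hyd =>
      ⟨isSMulRegular_of_quotSMulTop hx hxM h hyd, hyd⟩⟩
  | succ d ih =>
    refine ⟨supportDim_le_succ hx h.supportDim_le, fun y hy hyd =>
      ⟨isSMulRegular_of_quotSMulTop hx hxM h hyd, ?_⟩⟩
    obtain ⟨z, hz, hz₁, hz₂, -⟩ := exists_parameter₃ (QuotSMulTop x M) (QuotSMulTop y M) M (S := S)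
    have hzx := hz₁ _ h.supportDim_le
    have hzy := hz₂ _ hyd
    obtain ⟨hzM, hxz⟩ := isSMulRegular_swap hx hz hxM (h.isSMulRegular hz hzx)
    have h1 : IsCM S (d + 1) (QuotSMulTop z M) :=
      ih hx hxz ((h.quotSMulTop hz hzx).congr (quotSMulTopSwap z x M))
    have hyz : supportDim S (QuotSMulTop y (QuotSMulTop z M)) ≤ d := by
      rwa [supportDim_eq_of_equiv (quotSMulTopSwap y z M)]
    obtain ⟨-, hzy'⟩ := isSMulRegular_swap hz hy hzM (h1.isSMulRegular hy hyz)
    exact ih hz hzy' ((h1.quotSMulTop hy hyz).congr (quotSMulTopSwap y z M))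

omit [IsNoetherianRing S] in
/-- Extensions of Cohen–Macaulay modules of the same dimension are Cohen–Macaulay. -/
theorem of_exact {d : ℕ} {A B C : Type v} [AddCommGroup A] [Module S A] [Module.Finite S A]
    [AddCommGroup B] [Module S B] [Module.Finite S B]
    [AddCommGroup C] [Module S C] [Module.Finite S C] {f : A →ₗ[S] B} {g : B →ₗ[S] C}
    (hf : Function.Injective f) (hfg : Function.Exact f g) (hg : Function.Surjective g)
    (hA : IsCM S d A) (hC : IsCM S d C) : IsCM S d B := by
  induction d generalizing A B C with
  | zero =>
    rw [IsCM, supportDim_eq_zdim, support_of_exact hfg hf hg]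
    exact zdim_union_le isClosed_support isClosed_support hA hC
  | succ d ih =>
    refine ⟨?_, fun x hx hd => ?_⟩
    · rw [supportDim_eq_zdim, support_of_exact hfg hf hg]
      exact zdim_union_le isClosed_support isClosed_support hA.supportDim_le hC.supportDim_le
    · have hA' : supportDim S (QuotSMulTop x A) ≤ d := by
        refine le_trans ?_ hd
        rw [supportDim_eq_zdim, supportDim_eq_zdim, support_quotSMulTop, support_quotSMulTop]
        exact zdim_mono (Set.inter_subset_inter_left _ (support_subset_of_injective f hf))
      have hC' : supportDim S (QuotSMulTop x C) ≤ d :=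
        (supportDim_le_of_surjective _ (QuotSMulTop.map_surjective x hg)).trans hd
      have hxA := hA.isSMulRegular hx hA'
      have hxC := hC.isSMulRegular hx hC'
      refine ⟨isSMulRegular_of_range_eq_ker hf hfg.linearMap_ker_eq.symm hxA hxC, ?_⟩
      refine ih (quotSMulTop_map_injective hf fun b a hab => ?_) (QuotSMulTop.map_exact x hfg hg)
        (QuotSMulTop.map_surjective x hg) (hA.quotSMulTop hx hA') (hC.quotSMulTop hx hC')
      have : g b = 0 := isSMulRegular_iff_right_eq_zero_of_smul.1 hxC _ (by
        rw [← map_smul, ← hab, hfg.apply_apply_eq_zero])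
      obtain ⟨a', ha'⟩ := (hfg b).1 this
      exact ⟨a', ha'.symm⟩

/-- The cokernel of an injection of Cohen–Macaulay modules is Cohen–Macaulay if its dimension
drops. -/
theorem of_exact_of_supportDim_le {d : ℕ} {A B C : Type v} [AddCommGroup A] [Module S A]
    [Module.Finite S A] [AddCommGroup B] [Module S B] [Module.Finite S B]
    [AddCommGroup C] [Module S C] [Module.Finite S C] {f : A →ₗ[S] B} {g : B →ₗ[S] C}
    (hf : Function.Injective f) (hfg : Function.Exact f g) (hg : Function.Surjective g)
    (hA : IsCM S (d + 1) A) (hB : IsCM S (d + 1) B) (hC : supportDim S C ≤ d) : IsCM S d C := by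
  induction d generalizing A B C with
  | zero => exact hC
  | succ d ih =>
    obtain ⟨z, hz, hzA, hzB, hzC⟩ := exists_parameter₃ A B C (S := S)
    replace hzA := hzA _ hA.supportDim_le
    replace hzB := hzB _ hB.supportDim_le
    replace hzC := hzC _ hC
    have hA' := hA.quotSMulTop hz hzA
    have hB' := hB.quotSMulTop hz hzB
    have hregB := hB.isSMulRegular hz hzB
    have hinj : Function.Injective (QuotSMulTop.map z f) := by
      let K := LinearMap.ker (QuotSMulTop.map z f)
      have hK : supportDim S K ≤ d := by
        refine le_trans ?_ hzC
        rw [supportDim_eq_zdim, supportDim_eq_zdim, support_quotSMulTop]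
        refine zdim_mono (Set.subset_inter (fun p hp => ?_) (fun p hp => ?_))
        · rw [mem_support_iff_of_finite] at hp ⊢
          refine le_trans (fun r hr => ?_) hp
          rw [mem_annihilator] at hr ⊢
          rintro ⟨a, ha⟩
          apply Subtype.ext
          obtain ⟨a, rfl⟩ := Submodule.Quotient.mk_surjective _ a
          rw [LinearMap.mem_ker, QuotSMulTop.map_apply_mk, quotSMulTop_mk_eq_zero] at ha
          obtain ⟨b, hb⟩ := ha
          obtain ⟨a', ha'⟩ := (hfg (r • b)).1 (by rw [map_smul, hr])
          change r • (Submodule.Quotient.mk a : QuotSMulTop z A) = 0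
          rw [← Submodule.Quotient.mk_smul, quotSMulTop_mk_eq_zero]
          refine ⟨a', hf ?_⟩
          rw [map_smul, map_smul, hb, ha', smul_comm]
        · rw [PrimeSpectrum.mem_zeroLocus, Set.singleton_subset_iff]
          refine annihilator_le_of_mem_support hp (mem_annihilator.2 ?_)
          rintro ⟨a, ha⟩
          apply Subtype.ext
          obtain ⟨a, rfl⟩ := Submodule.Quotient.mk_surjective _ a
          change z • (Submodule.Quotient.mk a : QuotSMulTop z A) = 0
          rw [← Submodule.Quotient.mk_smul, quotSMulTop_mk_eq_zero]
          exact ⟨a, rfl⟩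
      have hsub := hA'.subsingleton_of_injective K.subtype K.subtype_injective hK
      rw [← LinearMap.ker_eq_bot]
      exact Submodule.subsingleton_iff_eq_bot.1 hsub
    have hC' := ih hinj (QuotSMulTop.map_exact z hfg hg) (QuotSMulTop.map_surjective z hg)
      hA' hB' hzC
    refine of_quotSMulTop hz (isSMulRegular_iff_right_eq_zero_of_smul.2 fun c hc => ?_) hC'
    obtain ⟨b, rfl⟩ := hg c
    rw [← map_smul] at hc
    obtain ⟨a, ha⟩ := (hfg _).1 hc
    have h0 : (Submodule.Quotient.mk a : QuotSMulTop z A) = 0 := hinj (by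
      rw [QuotSMulTop.map_apply_mk, map_zero, quotSMulTop_mk_eq_zero]
      exact ⟨b, ha⟩)
    obtain ⟨a', rfl⟩ := quotSMulTop_mk_eq_zero.1 h0
    rw [map_smul] at ha
    rw [← hregB ha, hfg.apply_apply_eq_zero]

end IsCM

namespace IsCM

variable {S : Type u} [CommRing S] [IsNoetherianRing S] [IsLocalRing S]

/-- Parameters on a Cohen–Macaulay module form a regular sequence with Cohen–Macaulay quotient. -/
theorem isWeaklyRegular_and_quotient {d : ℕ} {M : Type v} [AddCommGroup M] [Module S M]
    [Module.Finite S M] (l : List S) (hl : ∀ x ∈ l, x ∈ maximalIdeal S)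
    (hM : IsCM S (d + l.length) M)
    (h : zdim (support S M ∩ PrimeSpectrum.zeroLocus {x | x ∈ l}) ≤ d) :
    RingTheory.Sequence.IsWeaklyRegular M l ∧
      IsCM S d (M ⧸ (Ideal.ofList l • ⊤ : Submodule S M)) := by
  induction l generalizing M with
  | nil =>
    refine ⟨.nil S M, ?_⟩
    have e : M ≃ₗ[S] M ⧸ (Ideal.ofList ([] : List S) • ⊤ : Submodule S M) :=
      (Submodule.quotEquivOfEqBot (Ideal.ofList ([] : List S) • ⊤ : Submodule S M) (by
        rw [Ideal.ofList_nil]; exact Submodule.bot_smul _)).symm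
    exact congr e hM
  | cons x l ih =>
    have hx := hl x (by simp)
    have hs : {y | y ∈ x :: l} = {x} ∪ {y | y ∈ l} := by ext; simp
    rw [hs, PrimeSpectrum.zeroLocus_union, ← Set.inter_assoc, ← support_quotSMulTop] at h
    have hd : supportDim S (QuotSMulTop x M) ≤ (d + l.length : ℕ) :=
      zdim_le_inter_zeroLocus_list_add isClosed_support l (fun y hy => hl y (by simp [hy])) h
    obtain ⟨h1, h2⟩ := ih (fun y hy => hl y (by simp [hy])) (hM.quotSMulTop hx hd) h
    exact ⟨.cons (hM.isSMulRegular hx hd) h1,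
      h2.congr (Submodule.quotOfListConsSMulTopEquivQuotSMulTopInner M x l).symm⟩

/-- A module is Cohen–Macaulay if its quotient by a regular sequence is. -/
theorem of_isWeaklyRegular {d : ℕ} {M : Type v} [AddCommGroup M] [Module S M]
    [Module.Finite S M] (l : List S) (hl : ∀ x ∈ l, x ∈ maximalIdeal S)
    (h : RingTheory.Sequence.IsWeaklyRegular M l)
    (hM : IsCM S d (M ⧸ (Ideal.ofList l • ⊤ : Submodule S M))) : IsCM S (d + l.length) M := by
  induction l generalizing M with
  | nil =>
    have e : M ≃ₗ[S] M ⧸ (Ideal.ofList ([] : List S) • ⊤ : Submodule S M) :=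
      (Submodule.quotEquivOfEqBot (Ideal.ofList ([] : List S) • ⊤ : Submodule S M) (by
        rw [Ideal.ofList_nil]; exact Submodule.bot_smul _)).symm
    exact congr e.symm hM
  | cons x l ih =>
    rw [RingTheory.Sequence.isWeaklyRegular_cons_iff] at h
    exact of_quotSMulTop (hl x (by simp)) h.1 (ih (fun y hy => hl y (by simp [hy])) h.2
      (hM.congr (Submodule.quotOfListConsSMulTopEquivQuotSMulTopInner M x l)))

omit [IsNoetherianRing S] in
theorem pi {d : ℕ} (h : IsCM S d S) (k : ℕ) : IsCM S d (Fin k → S) := by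
  induction k with
  | zero => exact of_subsingleton d _
  | succ k ih =>
    refine of_exact (f := LinearMap.single S (fun _ : Fin (k + 1) => S) 0)
      (g := LinearMap.funLeft S S Fin.succ) ?_ ?_ ?_ h ih
    · exact Pi.single_injective (M := fun _ : Fin (k + 1) => S) 0
    · intro v
      constructor
      · intro hv
        refine ⟨v 0, ?_⟩
        ext i
        refine Fin.cases ?_ (fun j => ?_) i
        · simp
        · simpa [LinearMap.funLeft] using (congrFun hv j).symm
      · rintro ⟨a, rfl⟩
        ext j
        simp [LinearMap.funLeft]
    · exact LinearMap.funLeft_surjective_of_injective _ _ _ (Fin.succ_injective _)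

end IsCM

/-- Reduction modulo `x` commutes with the quotient by a cyclic submodule. -/
noncomputable def quotSMulTopQuotSpan {S : Type u} [CommRing S] (x : S) {P : Type v}
    [AddCommGroup P] [Module S P] (e : P) :
    QuotSMulTop x (P ⧸ Submodule.span S {e}) ≃ₗ[S]
      QuotSMulTop x P ⧸ Submodule.span S {(Submodule.Quotient.mk e : QuotSMulTop x P)} :=
  Submodule.quotEquivOfEq _ ((x • (⊤ : Submodule S P)).map (Submodule.span S {e}).mkQ) (by
    rw [Submodule.map_pointwise_smul, Submodule.map_top, Submodule.range_mkQ]) ≪≫ₗ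
  Submodule.quotientQuotientEquivQuotientSup _ _ ≪≫ₗ
  Submodule.quotEquivOfEq _ _ (sup_comm _ _) ≪≫ₗ
  (Submodule.quotientQuotientEquivQuotientSup _ _).symm ≪≫ₗ
  Submodule.quotEquivOfEq _ _ (by rw [Submodule.map_span, Set.image_singleton]; rfl)

namespace IsCM

variable {S : Type u} [CommRing S] [IsNoetherianRing S] [IsLocalRing S]

omit [IsNoetherianRing S] in
lemma quotient_span_smul {c : ℕ} {P : Type v} [AddCommGroup P] [Module S P]
    [Module.Finite S P] (e : P) {x : S} (hx : x ∈ maximalIdeal S) (hP : IsCM S (c + 1) P)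
    (hPe : IsCM S c (P ⧸ Submodule.span S {e})) (hd : supportDim S (QuotSMulTop x P) ≤ c) :
    IsCM S c (P ⧸ Submodule.span S {x • e}) := by
  have hreg := hP.isSMulRegular hx hd
  let f : (P ⧸ Submodule.span S {e}) →ₗ[S] (P ⧸ Submodule.span S {x • e}) :=
    Submodule.mapQ _ _ (LinearMap.lsmul S P x) (by
      rw [Submodule.span_singleton_le_iff_mem]
      exact Submodule.mem_span_singleton_self _)
  let g : (P ⧸ Submodule.span S {x • e}) →ₗ[S] QuotSMulTop x P := Submodule.factor (by
    rw [Submodule.span_singleton_le_iff_mem]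
    exact Submodule.smul_mem_pointwise_smul _ _ _ trivial)
  have hfmk : ∀ p : P, f (Submodule.Quotient.mk p) = Submodule.Quotient.mk (x • p) := fun _ => rfl
  have hgmk : ∀ p : P, g (Submodule.Quotient.mk p) = Submodule.Quotient.mk p := fun _ => rfl
  refine of_exact (f := f) (g := g) ?_ ?_ ?_ hPe (hP.quotSMulTop hx hd)
  · refine (injective_iff_map_eq_zero _).2 fun p hp => ?_
    obtain ⟨p, rfl⟩ := Submodule.Quotient.mk_surjective _ p
    rw [hfmk, Submodule.Quotient.mk_eq_zero, Submodule.mem_span_singleton] at hp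
    obtain ⟨s, hs⟩ := hp
    rw [Submodule.Quotient.mk_eq_zero, Submodule.mem_span_singleton]
    rw [smul_comm] at hs
    exact ⟨s, hreg hs⟩
  · intro p
    obtain ⟨p, rfl⟩ := Submodule.Quotient.mk_surjective _ p
    rw [hgmk, quotSMulTop_mk_eq_zero]
    constructor
    · rintro ⟨q, rfl⟩
      exact ⟨Submodule.Quotient.mk q, rfl⟩
    · rintro ⟨q, hq⟩
      obtain ⟨q, rfl⟩ := Submodule.Quotient.mk_surjective _ q
      rw [hfmk, Submodule.Quotient.eq, Submodule.mem_span_singleton] at hq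
      obtain ⟨s, hs⟩ := hq
      refine ⟨q - s • e, ?_⟩
      rw [smul_sub, smul_comm, hs]
      abel
  · intro p
    obtain ⟨p, rfl⟩ := Submodule.Quotient.mk_surjective _ p
    exact ⟨Submodule.Quotient.mk p, rfl⟩

/-- The quotient of a Cohen–Macaulay module `P` by an element `∑ xᵢ vᵢ + x e` is Cohen–Macaulay
if `P / e` is, provided that the `xᵢ` and `x` are generic enough. -/
theorem quotient_span_sum {c m : ℕ} {P : Type v} [AddCommGroup P] [Module S P]
    [Module.Finite S P] (e : P) {x : S} (hx : x ∈ maximalIdeal S) (xs : Fin m → S)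
    (hxs : ∀ i, xs i ∈ maximalIdeal S) (vs : Fin m → P) (hP : IsCM S (c + m + 1) P)
    (hPe : IsCM S (c + m) (P ⧸ Submodule.span S {e}))
    (h₁ : zdim (support S P ∩ PrimeSpectrum.zeroLocus (insert x (Set.range xs))) ≤ c)
    (h₂ : zdim (support S (P ⧸ Submodule.span S {e}) ∩
      PrimeSpectrum.zeroLocus (Set.range xs)) ≤ c)
    (hgen : ∀ (t : Set (Fin m)) (f : S),
      (∀ p : P, f • p ∈ (Ideal.span (xs '' t) • ⊤ : Submodule S P)) →
      ∃ f₀, (∀ p : P, f₀ • p = 0) ∧ f - f₀ ∈ Ideal.span (xs '' t)) :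
    IsCM S (c + m) (P ⧸ Submodule.span S {∑ i, xs i • vs i + x • e}) := by
  induction m generalizing P with
  | zero =>
    rw [Fin.sum_univ_zero, zero_add]
    refine quotient_span_smul e hx hP hPe ?_
    rw [supportDim_eq_zdim, support_quotSMulTop]
    simpa using h₁
  | succ m ih =>
    set w := ∑ i, xs i • vs i + x • e with hw
    let ē : QuotSMulTop (xs 0) P := Submodule.Quotient.mk e
    let v' : Fin m → QuotSMulTop (xs 0) P := fun i => Submodule.Quotient.mk (vs i.succ)
    have hwmk : (Submodule.Quotient.mk w : QuotSMulTop (xs 0) P) =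
        ∑ i, xs i.succ • v' i + x • ē := by
      have h0 : (Submodule.Quotient.mk (xs 0 • vs 0) : QuotSMulTop (xs 0) P) = 0 :=
        quotSMulTop_mk_eq_zero.2 ⟨_, rfl⟩
      rw [hw, Fin.sum_univ_succ, add_assoc, Submodule.Quotient.mk_add, h0, zero_add,
        Submodule.Quotient.mk_add, Submodule.Quotient.mk_smul, ← Submodule.mkQ_apply, map_sum]
      rfl
    have hrange : Set.range xs = {xs 0} ∪ Set.range fun i : Fin m => xs i.succ := by
      ext y; simp [Fin.exists_fin_succ, eq_comm]
    have hd₁ : zdim (support S (QuotSMulTop (xs 0) P) ∩ PrimeSpectrum.zeroLocus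
        (insert x (Set.range fun i : Fin m => xs i.succ))) ≤ c := by
      rwa [support_quotSMulTop, Set.inter_assoc, ← PrimeSpectrum.zeroLocus_union,
        Set.union_insert, ← hrange]
    have hd₂ : zdim (support S (QuotSMulTop (xs 0) (P ⧸ Submodule.span S {e})) ∩
        PrimeSpectrum.zeroLocus (Set.range fun i : Fin m => xs i.succ)) ≤ c := by
      rwa [support_quotSMulTop, Set.inter_assoc, ← PrimeSpectrum.zeroLocus_union, ← hrange]
    have hP0 : supportDim S (QuotSMulTop (xs 0) P) ≤ (c + m + 1 : ℕ) := by
      have := zdim_le_inter_zeroLocus_list_add (isClosed_support (R := S)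
        (M := QuotSMulTop (xs 0) P)) (x :: List.ofFn fun i : Fin m => xs i.succ)
        (by
          intro y hy
          rw [List.mem_cons, List.mem_ofFn'] at hy
          rcases hy with rfl | ⟨i, rfl⟩
          exacts [hx, hxs _]) (d := c) (by
            have hs : {y | y ∈ x :: List.ofFn fun i : Fin m => xs i.succ} =
              insert x (Set.range fun i : Fin m => xs i.succ) := by
                ext; simp [List.mem_ofFn', eq_comm]
            rwa [hs])
      rwa [List.length_cons, List.length_ofFn, ← add_assoc] at this
    have hPe0 : supportDim S (QuotSMulTop (xs 0) (P ⧸ Submodule.span S {e})) ≤ (c + m : ℕ) := by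
      have := zdim_le_inter_zeroLocus_list_add (isClosed_support (R := S)
        (M := QuotSMulTop (xs 0) (P ⧸ Submodule.span S {e})))
        (List.ofFn fun i : Fin m => xs i.succ)
        (by
          intro y hy
          rw [List.mem_ofFn'] at hy
          obtain ⟨i, rfl⟩ := hy
          exact hxs _) (d := c) (by
            have hs : {y | y ∈ List.ofFn fun i : Fin m => xs i.succ} =
              (Set.range fun i : Fin m => xs i.succ) := by
                ext; simp [List.mem_ofFn']
            rwa [hs])
      rwa [List.length_ofFn] at this
    have hreg := hP.isSMulRegular (d := c + m + 1) (hxs 0) hP0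
    have hP' : IsCM S (c + m + 1) (QuotSMulTop (xs 0) P) :=
      IsCM.quotSMulTop (d := c + m + 1) hP (hxs 0) hP0
    have hPe' : IsCM S (c + m) (QuotSMulTop (xs 0) P ⧸ Submodule.span S {ē}) :=
      (IsCM.quotSMulTop (d := c + m) hPe (hxs 0) hPe0).congr (quotSMulTopQuotSpan (xs 0) e)
    have hsupp : support S (QuotSMulTop (xs 0) (P ⧸ Submodule.span S {e})) =
        support S (QuotSMulTop (xs 0) P ⧸ Submodule.span S {ē}) :=
      (quotSMulTopQuotSpan (xs 0) e).support_eq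
    rw [hsupp] at hd₂
    have hmain := ih ē (fun i => xs i.succ) (fun i => hxs _) v' hP' hPe' hd₁ hd₂ (by
      intro t f hf
      have himg : xs '' (insert 0 (Fin.succ '' t)) =
          insert (xs 0) ((fun i : Fin m => xs i.succ) '' t) := by
        rw [Set.image_insert_eq, Set.image_image]
      obtain ⟨f₀, hf₀, hff₀⟩ := hgen (insert 0 (Fin.succ '' t)) f (by
        intro p
        rw [himg]
        have h1 := hf (Submodule.Quotient.mk p)
        rw [← Submodule.Quotient.mk_smul, ← Submodule.range_mkQ, ← Submodule.map_top,
          ← Submodule.map_smul''] at h1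
        obtain ⟨q, hq, hqp⟩ := h1
        rw [Submodule.mkQ_apply, Submodule.Quotient.eq,
          Submodule.mem_smul_pointwise_iff_exists] at hqp
        obtain ⟨r, -, hr⟩ := hqp
        have : f • p = q - xs 0 • r := by rw [hr]; abel
        rw [this]
        refine sub_mem ?_ ?_
        · exact Submodule.smul_mono_left (Ideal.span_mono (Set.subset_insert _ _)) hq
        · exact Submodule.smul_mem_smul (Ideal.subset_span (Set.mem_insert _ _)) trivial)
      rw [himg, Ideal.span_insert, Submodule.mem_sup] at hff₀
      obtain ⟨y, hy, z, hz, hyz⟩ := hff₀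
      obtain ⟨a, rfl⟩ := Ideal.mem_span_singleton'.1 hy
      refine ⟨f₀ + a * xs 0, fun p => ?_, ?_⟩
      · obtain ⟨p, rfl⟩ := Submodule.Quotient.mk_surjective _ p
        rw [← Submodule.Quotient.mk_smul, quotSMulTop_mk_eq_zero]
        exact ⟨a • p, by rw [add_smul, hf₀, zero_add, mul_comm, mul_smul]⟩
      · have : f - (f₀ + a * xs 0) = z := by rw [← sub_sub, ← hyz]; ring
        rwa [this])
    rw [← hwmk] at hmain
    refine of_quotSMulTop (d := c + m) (hxs 0) ?_ (hmain.congr (quotSMulTopQuotSpan (xs 0) w).symm)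
    rw [isSMulRegular_iff_right_eq_zero_of_smul]
    intro u hu
    obtain ⟨u, rfl⟩ := Submodule.Quotient.mk_surjective _ u
    rw [← Submodule.Quotient.mk_smul, Submodule.Quotient.mk_eq_zero,
      Submodule.mem_span_singleton] at hu
    obtain ⟨f, hf⟩ := hu
    let N := LinearMap.range (LinearMap.lsmul S (QuotSMulTop (xs 0) P) f)
    have hN : supportDim S N ≤ (c + m : ℕ) := by
      let F : (QuotSMulTop (xs 0) P ⧸
          Submodule.span S {(Submodule.Quotient.mk w : QuotSMulTop (xs 0) P)}) →ₗ[S] N :=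
        Submodule.liftQ _ (LinearMap.lsmul S (QuotSMulTop (xs 0) P) f).rangeRestrict (by
          rw [Submodule.span_singleton_le_iff_mem, LinearMap.mem_ker]
          apply Subtype.ext
          change f • (Submodule.Quotient.mk w : QuotSMulTop (xs 0) P) = 0
          rw [← Submodule.Quotient.mk_smul, quotSMulTop_mk_eq_zero]
          exact ⟨u, hf⟩)
      refine (supportDim_le_of_surjective F ?_).trans hmain.supportDim_le
      rintro ⟨_, p, rfl⟩
      exact ⟨Submodule.Quotient.mk p, rfl⟩
    have hsub := hP'.subsingleton_of_injective N.subtype N.subtype_injective hN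
    obtain ⟨f₀, hf₀, hff₀⟩ := hgen {0} f (by
      intro p
      have : f • (Submodule.Quotient.mk p : QuotSMulTop (xs 0) P) = 0 :=
        congrArg Subtype.val (Subsingleton.elim
          (⟨f • (Submodule.Quotient.mk p : QuotSMulTop (xs 0) P), ⟨_, rfl⟩⟩ : N) 0)
      rw [← Submodule.Quotient.mk_smul, quotSMulTop_mk_eq_zero] at this
      obtain ⟨q, hq⟩ := this
      rw [hq]
      exact Submodule.smul_mem_smul (Ideal.subset_span ⟨0, rfl, rfl⟩) trivial)
    rw [Set.image_singleton] at hff₀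
    obtain ⟨a, ha⟩ := Ideal.mem_span_singleton'.1 hff₀
    rw [Submodule.Quotient.mk_eq_zero, Submodule.mem_span_singleton]
    refine ⟨a, hreg ?_⟩
    change xs 0 • a • w = xs 0 • u
    rw [← hf, ← mul_smul, mul_comm, ha, sub_smul, hf₀, sub_zero]

end IsCM

section Cokernel

variable {S : Type u} [CommRing S]

/-- The cokernel of the linear map given by a matrix. -/
abbrev Matrix.Coker {k n : ℕ} (A : Matrix (Fin k) (Fin n) S) : Type u :=
  (Fin k → S) ⧸ LinearMap.range A.mulVecLin

lemma Matrix.Coker.mk_eq_zero {k n : ℕ} {A : Matrix (Fin k) (Fin n) S} {v : Fin k → S} :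
    (Submodule.Quotient.mk v : A.Coker) = 0 ↔ ∃ u, A.mulVec u = v := by
  rw [Submodule.Quotient.mk_eq_zero]; rfl

/-- The quotient of a quotient by a cyclic submodule. -/
noncomputable def quotientSpanEquiv {V : Type v} [AddCommGroup V] [Module S V]
    (N N' : Submodule S V) (w : V) (h : N' = N ⊔ Submodule.span S {w}) :
    (V ⧸ N') ≃ₗ[S] ((V ⧸ N) ⧸ Submodule.span S {(Submodule.Quotient.mk w : V ⧸ N)}) :=
  Submodule.quotEquivOfEq _ _ h ≪≫ₗ
  (Submodule.quotientQuotientEquivQuotientSup _ _).symm ≪≫ₗ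
  Submodule.quotEquivOfEq _ _ (by rw [Submodule.map_span, Set.image_singleton]; rfl)

lemma Matrix.range_mulVecLin_succ {k n : ℕ} (A : Matrix (Fin k) (Fin (n + 1)) S) :
    LinearMap.range A.mulVecLin = LinearMap.range (A.submatrix id Fin.succ).mulVecLin ⊔
      Submodule.span S {A.col 0} := by
  rw [Matrix.range_mulVecLin, Matrix.range_mulVecLin, ← Submodule.span_union]
  congr 1
  ext v
  simp only [Set.mem_range, Set.union_singleton, Set.mem_insert_iff, Fin.exists_fin_succ]
  rw [eq_comm]
  rfl

/-- The cokernel of a matrix as a quotient of the cokernel of all but its first column. -/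
noncomputable def Matrix.cokerSuccEquiv {k n : ℕ} (A : Matrix (Fin k) (Fin (n + 1)) S) :
    A.Coker ≃ₗ[S] (A.submatrix id Fin.succ).Coker ⧸
      Submodule.span S {(Submodule.Quotient.mk (A.col 0) : (A.submatrix id Fin.succ).Coker)} :=
  quotientSpanEquiv _ _ _ A.range_mulVecLin_succ

lemma Matrix.exists_coker_span_single_equiv {k n : ℕ} (A : Matrix (Fin (k + 1)) (Fin n) S) :
    Nonempty ((A.Coker ⧸ Submodule.span S {(Submodule.Quotient.mk (Pi.single 0 1) : A.Coker)})
      ≃ₗ[S] (A.submatrix Fin.succ id).Coker) := by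
  let F : (Fin (k + 1) → S) →ₗ[S] (A.submatrix Fin.succ id).Coker :=
    (Submodule.mkQ _).comp (LinearMap.funLeft S S Fin.succ)
  have hF : Function.Surjective F := (Submodule.mkQ_surjective _).comp
    (LinearMap.funLeft_surjective_of_injective _ _ _ (Fin.succ_injective _))
  have hker : LinearMap.ker F = LinearMap.range A.mulVecLin ⊔
      Submodule.span S {(Pi.single 0 1 : Fin (k + 1) → S)} := by
    apply le_antisymm
    · intro v hv
      obtain ⟨u, hu⟩ := Matrix.Coker.mk_eq_zero.1 hv
      rw [Submodule.mem_sup]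
      refine ⟨A.mulVec u, ⟨u, rfl⟩, (v 0 - A.mulVec u 0) • Pi.single 0 1,
        Submodule.smul_mem _ _ (Submodule.mem_span_singleton_self _), ?_⟩
      ext i
      refine Fin.cases ?_ (fun i => ?_) i
      · simp
      · have := congrFun hu i
        simpa [Matrix.mulVec, dotProduct, LinearMap.funLeft] using this
    · rw [sup_le_iff, Submodule.span_singleton_le_iff_mem]
      constructor
      · rintro _ ⟨u, rfl⟩
        exact Matrix.Coker.mk_eq_zero.2 ⟨u, rfl⟩
      · refine Matrix.Coker.mk_eq_zero.2 ⟨0, ?_⟩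
        ext i
        simp [LinearMap.funLeft]
  exact ⟨(quotientSpanEquiv _ _ _ hker).symm ≪≫ₗ F.quotKerEquivOfSurjective hF⟩

lemma Matrix.pow_mem_of_smul_coker {k : ℕ} (A : Matrix (Fin k) (Fin k) S) {a : S}
    (ha : ∀ v : A.Coker, a • v = 0) : a ^ k ∈ Ideal.span {A.det} := by
  choose b hb using fun i => Matrix.Coker.mk_eq_zero.1 ((Submodule.Quotient.mk_smul _ a
    (Pi.single i 1 : Fin k → S)).trans (ha _))
  have h : A * (Matrix.of b).transpose = a • (1 : Matrix (Fin k) (Fin k) S) := by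
    ext i j
    have := congrFun (hb j) i
    rw [Matrix.smul_apply, Matrix.mul_apply]
    simpa [Matrix.mulVec, dotProduct, Pi.single_apply, Matrix.one_apply, eq_comm] using this
  have h2 := congrArg Matrix.det h
  rw [Matrix.det_mul, Matrix.det_smul, Matrix.det_one, mul_one, Fintype.card_fin] at h2
  rw [← h2]
  exact Ideal.mul_mem_right _ _ (Ideal.mem_span_singleton_self _)

lemma Matrix.zeroLocus_det_subset_support_coker {k : ℕ} (A : Matrix (Fin k) (Fin k) S) :
    PrimeSpectrum.zeroLocus {A.det} ⊆ support S A.Coker := by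
  intro p hp
  rw [mem_support_iff_of_finite]
  intro a ha
  rw [mem_annihilator] at ha
  rw [PrimeSpectrum.mem_zeroLocus, Set.singleton_subset_iff] at hp
  exact p.2.mem_of_pow_mem k ((Ideal.span_singleton_le_iff_mem _).2 hp
    (A.pow_mem_of_smul_coker ha))

lemma support_quotient_inter_subset {P : Type v} [AddCommGroup P] [Module S P]
    [Module.Finite S P] (e : P) (x : S) {m : ℕ} (xs : Fin m → S) (vs : Fin m → P) :
    support S (P ⧸ Submodule.span S {∑ i, xs i • vs i + x • e}) ∩
        PrimeSpectrum.zeroLocus (Set.range xs) ⊆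
      (support S P ∩ PrimeSpectrum.zeroLocus (insert x (Set.range xs))) ∪
      support S (P ⧸ Submodule.span S {e}) := by
  set w := ∑ i, xs i • vs i + x • e with hw
  rintro p ⟨hp, hpx⟩
  by_cases hxp : x ∈ p.asIdeal
  · refine .inl ⟨support_subset_of_surjective _ (Submodule.mkQ_surjective _) hp, ?_⟩
    rw [PrimeSpectrum.mem_zeroLocus] at hpx ⊢
    exact Set.insert_subset hxp hpx
  · refine .inr ?_
    rw [mem_support_iff_of_finite]
    intro r hr
    rw [mem_annihilator] at hr
    let I := Ideal.span (Set.range xs)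
    have hpI : p ∈ support S ((P ⧸ Submodule.span S {w}) ⧸
        (I • ⊤ : Submodule S (P ⧸ Submodule.span S {w}))) := by
      rw [support_quotient]
      exact ⟨hp, by rwa [PrimeSpectrum.zeroLocus_span]⟩
    have hann : x * r ∈ annihilator S ((P ⧸ Submodule.span S {w}) ⧸
        (I • ⊤ : Submodule S (P ⧸ Submodule.span S {w}))) := by
      rw [mem_annihilator]
      intro q
      obtain ⟨q, rfl⟩ := Submodule.Quotient.mk_surjective _ q
      obtain ⟨q, rfl⟩ := Submodule.Quotient.mk_surjective _ q
      have h1 := hr (Submodule.Quotient.mk q)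
      rw [← Submodule.Quotient.mk_smul, Submodule.Quotient.mk_eq_zero,
        Submodule.mem_span_singleton] at h1
      obtain ⟨a, ha⟩ := h1
      rw [← Submodule.Quotient.mk_smul, Submodule.Quotient.mk_eq_zero, mul_smul,
        ← Submodule.Quotient.mk_smul, ← ha, ← Submodule.Quotient.mk_smul, smul_comm,
        show x • e = w - ∑ i, xs i • vs i by rw [hw]; abel,
        Submodule.Quotient.mk_smul, Submodule.Quotient.mk_sub,
        (Submodule.Quotient.mk_eq_zero _).2 (Submodule.mem_span_singleton_self w), zero_sub]
      refine Submodule.smul_mem _ _ (neg_mem ?_)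
      rw [← Submodule.mkQ_apply, map_sum]
      refine Submodule.sum_mem _ fun i _ => ?_
      rw [map_smul]
      exact Submodule.smul_mem_smul (Ideal.subset_span ⟨i, rfl⟩) trivial
    exact (p.2.mem_or_mem (annihilator_le_of_mem_support hpI hann)).resolve_left hxp

end Cokernel

section GenericFamily

lemma Matrix.exists_coker_equiv_span_sum {S : Type u} [CommRing S] {k n : ℕ}
    (A : Matrix (Fin (k + 1)) (Fin (n + 1)) S) :
    Nonempty (A.Coker ≃ₗ[S] (A.submatrix id Fin.succ).Coker ⧸ Submodule.span S
      {∑ i : Fin k, A i.succ 0 •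
          (Submodule.Quotient.mk (Pi.single i.succ 1) : (A.submatrix id Fin.succ).Coker) +
        A 0 0 • (Submodule.Quotient.mk (Pi.single 0 1) : (A.submatrix id Fin.succ).Coker)}) := by
  have h : (Submodule.Quotient.mk (A.col 0) : (A.submatrix id Fin.succ).Coker) =
      ∑ i : Fin k, A i.succ 0 •
          (Submodule.Quotient.mk (Pi.single i.succ 1) : (A.submatrix id Fin.succ).Coker) +
        A 0 0 • (Submodule.Quotient.mk (Pi.single 0 1) : (A.submatrix id Fin.succ).Coker) := by
    have h1 : A.col 0 = ∑ i : Fin k, A i.succ 0 • (Pi.single i.succ 1 : Fin (k + 1) → S) +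
        A 0 0 • (Pi.single 0 1 : Fin (k + 1) → S) := by
      conv_lhs => rw [pi_eq_sum_univ' (A.col 0), Fin.sum_univ_succ, add_comm]
      rfl
    rw [h1, Submodule.Quotient.mk_add, Submodule.Quotient.mk_smul, ← Submodule.mkQ_apply, map_sum]
    rfl
  rw [← h]
  exact ⟨A.cokerSuccEquiv⟩

variable {S : Type u} [CommRing S] [IsNoetherianRing S] [IsLocalRing S]

omit [IsNoetherianRing S] in
/-- A family of elements of a Cohen–Macaulay local ring behaving like a set of variables: they are
part of a system of parameters and any subset of them may be replaced by zero. -/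
structure IsGenericFamily {ι : Type w} [Fintype ι] (c : ℕ) (y : ι → S) : Prop where
  isCM : IsCM S (c + Fintype.card ι) S
  mem : ∀ i, y i ∈ maximalIdeal S
  zdim_le : zdim (PrimeSpectrum.zeroLocus (Set.range y)) ≤ c
  exists_subst : ∀ T : Set ι, ∃ θ : S →+* S, (∀ i ∈ T, θ (y i) = 0) ∧
    (∀ i ∉ T, θ (y i) = y i) ∧ ∀ f, θ f - f ∈ Ideal.span (y '' T)

namespace IsGenericFamily

variable {ι : Type w} [Fintype ι] {c : ℕ} {y : ι → S}

lemma zdim_zeroLocus_le (h : IsGenericFamily c y) (T : Finset ι) {d : ℕ}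
    (hd : d + T.card = c + Fintype.card ι) : zdim (PrimeSpectrum.zeroLocus (y '' T)) ≤ d := by
  classical
  have h1 := zdim_le_inter_zeroLocus_list_add
    (PrimeSpectrum.isClosed_zeroLocus (y '' T)) ((Tᶜ).toList.map y) (by
      intro x hx
      obtain ⟨i, -, rfl⟩ := List.mem_map.1 hx
      exact h.mem i) (d := c) (by
      refine le_trans (zdim_mono ?_) h.zdim_le
      rw [← PrimeSpectrum.zeroLocus_union]
      refine PrimeSpectrum.zeroLocus_anti_mono ?_
      rintro _ ⟨i, rfl⟩
      by_cases hi : i ∈ T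
      · exact .inl ⟨i, hi, rfl⟩
      · exact .inr (List.mem_map.2 ⟨i, by simpa using hi, rfl⟩))
  rw [List.length_map, Finset.length_toList, Finset.card_compl] at h1
  have h2 := T.card_le_univ
  rwa [show d = c + (Fintype.card ι - T.card) by omega]

lemma _root_.card_add_le_of_injective {ι : Type w} [Fintype ι] {k n : ℕ} (idx : Fin k → Fin n → ι)
    (hidx : Function.Injective fun p : Fin k × Fin n => idx p.1 p.2) (U : Finset ι)
    (hU : ∀ i j, idx i j ∉ U) : k * n + U.card ≤ Fintype.card ι := by
  classical
  have hdisj : Disjoint (Finset.univ.image fun p : Fin k × Fin n => idx p.1 p.2) U := by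
    rw [Finset.disjoint_left]
    intro i hi
    obtain ⟨p, -, rfl⟩ := Finset.mem_image.1 hi
    exact hU _ _
  have := Finset.card_le_univ ((Finset.univ.image fun p : Fin k × Fin n => idx p.1 p.2) ∪ U)
  rw [Finset.card_union_of_disjoint hdisj, Finset.card_image_of_injective _ hidx] at this
  simpa using this

/-- The dimension of the support of the cokernel of a matrix of indeterminates. -/
theorem zdim_support_coker_le (h : IsGenericFamily c y) {n k : ℕ} (hkn : k ≤ n + 1)
    (idx : Fin k → Fin n → ι)
    (hidx : Function.Injective fun p : Fin k × Fin n => idx p.1 p.2) (U : Finset ι)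
    (hU : ∀ i j, idx i j ∉ U) {d : ℕ} (hd : d + (n + 1) + U.card = c + Fintype.card ι + k) :
    zdim (support S (Matrix.of fun i j => y (idx i j)).Coker ∩
      PrimeSpectrum.zeroLocus (y '' U)) ≤ d := by
  classical
  rcases k with _ | k
  · rw [support_eq_empty, Set.empty_inter]
    have : zdim (∅ : Set (PrimeSpectrum S)) = ⊥ := Order.krullDim_eq_bot
    rw [this]
    exact bot_le
  induction n generalizing k U d with
  | zero =>
    exact (zdim_mono Set.inter_subset_right).trans (h.zdim_zeroLocus_le U (by omega))
  | succ n ih =>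
    obtain hk | hk := hkn.eq_or_lt
    · exact (zdim_mono Set.inter_subset_right).trans (h.zdim_zeroLocus_le U (by omega))
    have hcard := card_add_le_of_injective idx hidx U hU
    have hcard' : n + 1 + U.card ≤ Fintype.card ι := by nlinarith
    obtain ⟨d', hd'⟩ : ∃ d', d' + (n + 1 + U.card) = c + Fintype.card ι :=
      ⟨c + Fintype.card ι - (n + 1 + U.card), by omega⟩
    obtain rfl : d = d' + k := by omega
    set A := Matrix.of fun i j => y (idx i j) with hA
    obtain ⟨e⟩ := A.exists_coker_equiv_span_sum
    obtain ⟨e'⟩ := (A.submatrix id Fin.succ).exists_coker_span_single_equiv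
    have hinj : ∀ {i i' j j'}, idx i j = idx i' j' → i = i' ∧ j = j' := fun {i i' j j'} hh =>
      Prod.mk.inj (hidx (a₁ := (i, j)) (a₂ := (i', j')) hh)
    let U₀ := Finset.univ.image fun i => idx i 0
    let U₁ := Finset.univ.image fun i : Fin k => idx i.succ 0
    have hU₀ : (U ∪ U₀).card = U.card + (k + 1) := by
      rw [Finset.card_union_of_disjoint, Finset.card_image_of_injective, Finset.card_univ,
        Fintype.card_fin]
      · exact fun i i' hh => (hinj hh).1
      · rw [Finset.disjoint_right]
        intro i hi
        obtain ⟨p, -, rfl⟩ := Finset.mem_image.1 hi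
        exact hU _ _
    have hU₁ : (U ∪ U₁).card = U.card + k := by
      rw [Finset.card_union_of_disjoint, Finset.card_image_of_injective, Finset.card_univ,
        Fintype.card_fin]
      · exact fun i i' hh => Fin.succ_injective _ (hinj hh).1
      · rw [Finset.disjoint_right]
        intro i hi
        obtain ⟨p, -, rfl⟩ := Finset.mem_image.1 hi
        exact hU _ _
    have hP := ih (U ∪ U₀) (d := d') k (by omega) (fun i j => idx i j.succ)
      (fun p q hpq => by
        have := hinj hpq
        exact Prod.ext this.1 (Fin.succ_injective _ this.2))
      (fun i j hmem => by
        rcases Finset.mem_union.1 hmem with hm | hm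
        · exact hU _ _ hm
        · obtain ⟨p, -, hp⟩ := Finset.mem_image.1 hm
          exact Fin.succ_ne_zero _ (hinj hp).2.symm) (by omega)
    have hPe : zdim (support S ((A.submatrix id Fin.succ).submatrix Fin.succ id).Coker ∩
        PrimeSpectrum.zeroLocus (y '' ↑(U ∪ U₁))) ≤ d' := by
      rcases k with _ | k
      · rw [support_eq_empty, Set.empty_inter]
        have : zdim (∅ : Set (PrimeSpectrum S)) = ⊥ := Order.krullDim_eq_bot
        rw [this]
        exact bot_le
      · exact ih (U ∪ U₁) (d := d') k (by omega) (fun i j => idx i.succ j.succ)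
          (fun p q hpq => by
            have := hinj hpq
            exact Prod.ext (Fin.succ_injective _ this.1) (Fin.succ_injective _ this.2))
          (fun i j hmem => by
            rcases Finset.mem_union.1 hmem with hm | hm
            · exact hU _ _ hm
            · obtain ⟨p, -, hp⟩ := Finset.mem_image.1 hm
              exact Fin.succ_ne_zero _ (hinj hp).2.symm) (by omega)
    rw [← e'.support_eq] at hPe
    have hlist := zdim_le_inter_zeroLocus_list_add
      (Z := support S A.Coker ∩ PrimeSpectrum.zeroLocus (y '' U))
      (isClosed_support.inter (PrimeSpectrum.isClosed_zeroLocus _))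
      (List.ofFn fun i : Fin k => A i.succ 0) (by
        intro x hx
        rw [List.mem_ofFn'] at hx
        obtain ⟨i, rfl⟩ := hx
        exact h.mem _) (d := d') (by
        refine le_trans (zdim_mono ?_) (zdim_union_le (isClosed_support.inter
          (PrimeSpectrum.isClosed_zeroLocus _)) (isClosed_support.inter
          (PrimeSpectrum.isClosed_zeroLocus _)) hP hPe)
        rintro p ⟨⟨hp, hpU⟩, hpl⟩
        have hpl' : p ∈ PrimeSpectrum.zeroLocus (Set.range fun i : Fin k => A i.succ 0) := by
          refine PrimeSpectrum.zeroLocus_anti_mono ?_ hpl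
          rintro _ ⟨i, rfl⟩
          exact (List.mem_ofFn' _ _).2 ⟨i, rfl⟩
        rw [e.support_eq] at hp
        rw [PrimeSpectrum.mem_zeroLocus] at hpU
        rcases support_quotient_inter_subset _ _ _ _ ⟨hp, hpl'⟩ with ⟨h1, h2⟩ | h1
        · refine .inl ⟨h1, ?_⟩
          rw [PrimeSpectrum.mem_zeroLocus] at h2 ⊢
          rintro _ ⟨i, hi, rfl⟩
          rcases Finset.mem_union.1 hi with hi | hi
          · exact hpU ⟨i, hi, rfl⟩
          · obtain ⟨j, -, rfl⟩ := Finset.mem_image.1 hi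
            refine h2 (Fin.cases (.inl rfl) (fun j => .inr ⟨j, rfl⟩) j)
        · refine .inr ⟨h1, ?_⟩
          rw [PrimeSpectrum.mem_zeroLocus] at hpl' ⊢
          rintro _ ⟨i, hi, rfl⟩
          rcases Finset.mem_union.1 hi with hi | hi
          · exact hpU ⟨i, hi, rfl⟩
          · obtain ⟨j, -, rfl⟩ := Finset.mem_image.1 hi
            exact hpl' ⟨j, rfl⟩)
    rwa [List.length_ofFn] at hlist

end IsGenericFamily

end GenericFamily

section GenericFamily

variable {S : Type u} [CommRing S] [IsNoetherianRing S] [IsLocalRing S]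

namespace IsGenericFamily

variable {ι : Type w} [Fintype ι] {c : ℕ} {y : ι → S}

theorem isCM_coker_square (h : IsGenericFamily c y) {k d : ℕ} (idx : Fin k → Fin k → ι)
    (hidx : Function.Injective fun p : Fin k × Fin k => idx p.1 p.2)
    (hd : d + 1 = c + Fintype.card ι) :
    IsCM S d (Matrix.of fun i j => y (idx i j)).Coker := by
  classical
  rcases k with _ | k
  · exact IsCM.of_subsingleton _ _
  set A := Matrix.of fun i j => y (idx i j) with hA
  have hS : IsCM S (d + 1) S := hd ▸ h.isCM
  have hsupp := h.zdim_support_coker_le (d := d) (Nat.le_succ _) idx hidx ∅ (by simp) (by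
    rw [Finset.card_empty]; omega)
  rw [Finset.coe_empty, Set.image_empty, PrimeSpectrum.zeroLocus_empty, Set.inter_univ,
    ← hA] at hsupp
  have hdet : A.det ∈ maximalIdeal S := by
    rw [← residue_eq_zero_iff, RingHom.map_det]
    have : (residue S).mapMatrix A = 0 := by
      ext i j
      exact (residue_eq_zero_iff _).2 (h.mem _)
    rw [this, Matrix.det_zero]
  have hreg : IsSMulRegular S A.det := by
    refine hS.isSMulRegular hdet ?_
    rw [supportDim_eq_zdim, support_quotSMulTop]
    exact (zdim_mono (Set.inter_subset_right.trans
      A.zeroLocus_det_subset_support_coker)).trans hsupp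
  refine IsCM.of_exact_of_supportDim_le (f := A.mulVecLin)
    (g := (LinearMap.range A.mulVecLin).mkQ) ?_ (LinearMap.exact_map_mkQ_range _)
    (Submodule.mkQ_surjective _) (hS.pi _) (hS.pi _) hsupp
  refine (injective_iff_map_eq_zero _).2 fun v hv => ?_
  have h1 : A.det • v = 0 := by
    rw [Matrix.mulVecLin_apply] at hv
    have := congrArg A.adjugate.mulVec hv
    rwa [Matrix.mulVec_mulVec, Matrix.adjugate_mul, Matrix.smul_mulVec, Matrix.one_mulVec,
      Matrix.mulVec_zero] at this
  ext i
  exact isSMulRegular_iff_right_eq_zero_of_smul.1 hreg _ (congrFun h1 i)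

/-- The cokernel of a matrix of indeterminates is Cohen–Macaulay. -/
theorem isCM_coker (h : IsGenericFamily c y) {n k d : ℕ} (hkn : k ≤ n) (idx : Fin k → Fin n → ι)
    (hidx : Function.Injective fun p : Fin k × Fin n => idx p.1 p.2)
    (hd : d + n + 1 = c + Fintype.card ι + k) :
    IsCM S d (Matrix.of fun i j => y (idx i j)).Coker := by
  classical
  induction n generalizing k d with
  | zero =>
    obtain rfl : k = 0 := by omega
    exact IsCM.of_subsingleton _ _
  | succ n ih =>
    obtain rfl | hk := hkn.eq_or_lt
    · exact h.isCM_coker_square idx hidx (by omega)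
    rcases k with _ | k
    · exact IsCM.of_subsingleton _ _
    have hcard := card_add_le_of_injective idx hidx ∅ (by simp)
    rw [Finset.card_empty] at hcard
    have hcard' : n + 1 ≤ Fintype.card ι := by nlinarith
    obtain ⟨d', hd'⟩ : ∃ d', d' + (n + 1) = c + Fintype.card ι :=
      ⟨c + Fintype.card ι - (n + 1), by omega⟩
    obtain rfl : d = d' + k := by omega
    set A := Matrix.of fun i j => y (idx i j) with hA
    obtain ⟨e⟩ := A.exists_coker_equiv_span_sum
    obtain ⟨e'⟩ := (A.submatrix id Fin.succ).exists_coker_span_single_equiv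
    have hinj : ∀ {i i' j j'}, idx i j = idx i' j' → i = i' ∧ j = j' := fun {i i' j j'} hh =>
      Prod.mk.inj (hidx (a₁ := (i, j)) (a₂ := (i', j')) hh)
    have hidx₀ : Function.Injective fun p : Fin (k + 1) × Fin n => idx p.1 p.2.succ :=
      fun p q hpq => Prod.ext (hinj hpq).1 (Fin.succ_injective _ (hinj hpq).2)
    have hidx₁ : Function.Injective fun p : Fin k × Fin n => idx p.1.succ p.2.succ :=
      fun p q hpq => Prod.ext (Fin.succ_injective _ (hinj hpq).1)
        (Fin.succ_injective _ (hinj hpq).2)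
    have hP : IsCM S (d' + k + 1) (A.submatrix id Fin.succ).Coker :=
      ih (d := d' + k + 1) (by omega) (fun i j => idx i j.succ) hidx₀ (by omega)
    have hPe : IsCM S (d' + k) ((A.submatrix id Fin.succ).submatrix Fin.succ id).Coker :=
      ih (d := d' + k) (by omega) (fun i j => idx i.succ j.succ) hidx₁ (by omega)
    let U₀ := Finset.univ.image fun i => idx i 0
    let U₁ := Finset.univ.image fun i : Fin k => idx i.succ 0
    have hU₀ : U₀.card = k + 1 := by
      rw [Finset.card_image_of_injective _ fun i i' hh => (hinj hh).1, Finset.card_univ,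
        Fintype.card_fin]
    have hU₁ : U₁.card = k := by
      rw [Finset.card_image_of_injective _ fun i i' hh => Fin.succ_injective _ (hinj hh).1,
        Finset.card_univ, Fintype.card_fin]
    have hP' : zdim (support S (A.submatrix id Fin.succ).Coker ∩
        PrimeSpectrum.zeroLocus (insert (A 0 0) (Set.range fun i : Fin k => A i.succ 0))) ≤ d' := by
      have := h.zdim_support_coker_le (d := d') (by omega) (fun i j => idx i (Fin.succ j)) hidx₀ U₀
        (fun i j hm => by
          obtain ⟨p, -, hp⟩ := Finset.mem_image.1 hm
          exact Fin.succ_ne_zero _ (hinj hp).2.symm) (by omega)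
      have himg : y '' U₀ = insert (A 0 0) (Set.range fun i : Fin k => A i.succ 0) := by
        ext z
        simp [U₀, A, Fin.exists_fin_succ, eq_comm]
      rwa [himg] at this
    have hPe' : zdim (support S ((A.submatrix id Fin.succ).submatrix Fin.succ id).Coker ∩
        PrimeSpectrum.zeroLocus (Set.range fun i : Fin k => A i.succ 0)) ≤ d' := by
      have := h.zdim_support_coker_le (d := d') (by omega)
        (fun i j => idx (Fin.succ i) (Fin.succ j)) hidx₁ U₁
        (fun i j hm => by
          obtain ⟨p, -, hp⟩ := Finset.mem_image.1 hm
          exact Fin.succ_ne_zero _ (hinj hp).2.symm) (by omega)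
      have himg : y '' U₁ = Set.range fun i : Fin k => A i.succ 0 := by
        ext z
        simp [U₁, A, eq_comm]
      rwa [himg] at this
    rw [← e'.support_eq] at hPe'
    refine IsCM.congr e.symm (IsCM.quotient_span_sum _ (h.mem _) (fun i : Fin k => A i.succ 0)
      (fun i => h.mem _) _ hP (hPe.congr e'.symm) hP' hPe' ?_)
    intro t f hf
    have ht : (fun i : Fin k => A i.succ 0) '' t = y '' ((fun i : Fin k => idx i.succ 0) '' t) := by
      rw [Set.image_image]; rfl
    obtain ⟨θ, hθ₀, hθ₁, hθ⟩ := h.exists_subst ((fun i : Fin k => idx i.succ 0) '' t)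
    rw [ht] at hf ⊢
    refine ⟨θ f, fun p => ?_, by rw [← neg_sub]; exact neg_mem (hθ f)⟩
    set I := Ideal.span (y '' ((fun i : Fin k => idx i.succ 0) '' t)) with hI
    have hθI : ∀ a ∈ I, θ a = 0 := by
      have : I ≤ RingHom.ker θ := by
        rw [hI, Ideal.span_le]
        rintro _ ⟨i, hi, rfl⟩
        exact hθ₀ i hi
      exact fun a ha => this ha
    have hker : (Submodule.mkQ (LinearMap.range (A.submatrix id Fin.succ).mulVecLin)).comp
        (LinearMap.lsmul S (Fin (k + 1) → S) (θ f)) = 0 := by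
      refine LinearMap.pi_ext' fun i => LinearMap.ext_ring ?_
      have h1 := hf (Submodule.Quotient.mk (Pi.single i 1))
      have hmap : (I • ⊤ : Submodule S (A.submatrix id Fin.succ).Coker) =
          (I • ⊤ : Submodule S (Fin (k + 1) → S)).map (Submodule.mkQ _) := by
        rw [Submodule.map_smul'', Submodule.map_top, Submodule.range_mkQ]
      rw [← Submodule.Quotient.mk_smul, hmap] at h1
      obtain ⟨q, hq, hqp⟩ := h1
      rw [Submodule.mkQ_apply, Submodule.Quotient.eq] at hqp
      obtain ⟨u, hu⟩ := hqp
      have hqI : ∀ j, q j ∈ I := by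
        refine Submodule.smul_induction_on hq (fun r hr m _ j => ?_) (fun a b ha hb j => ?_)
        · exact I.mul_mem_right _ hr
        · exact I.add_mem (ha j) (hb j)
      refine Matrix.Coker.mk_eq_zero.2 ⟨fun j => - θ (u j), ?_⟩
      ext l
      have h2 := congrArg θ (congrFun hu l)
      rw [Matrix.mulVecLin_apply, Pi.sub_apply, map_sub, hθI _ (hqI l), zero_sub] at h2
      have h3 : θ ((f • (Pi.single i 1 : Fin (k + 1) → S)) l) =
          (θ f • (Pi.single i 1 : Fin (k + 1) → S)) l := by
        by_cases hil : l = i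
        · subst hil; simp
        · simp [hil]
      rw [h3] at h2
      refine Eq.trans ?_ (neg_eq_iff_eq_neg.2 h2)
      simp only [Matrix.mulVec, dotProduct, map_sum, map_mul, mul_neg, Finset.sum_neg_distrib]
      congr 1
      refine Finset.sum_congr rfl fun j _ => ?_
      congr 1
      refine (hθ₁ _ ?_).symm
      rintro ⟨i', -, hi'⟩
      exact Fin.succ_ne_zero _ (hinj hi').2.symm
    obtain ⟨v, rfl⟩ := Submodule.Quotient.mk_surjective _ p
    exact LinearMap.congr_fun hker v

end IsGenericFamily

end GenericFamily

lemma Matrix.exists_coker_quotient_semilinear {S : Type u} {R : Type v} [CommRing S] [CommRing R]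
    (π : S →+* R) (hπ : Function.Surjective π) {I : Ideal S} (hI : RingHom.ker π = I) {k n : ℕ}
    (B : Matrix (Fin k) (Fin n) S) :
    ∃ e : (B.Coker ⧸ (I • ⊤ : Submodule S B.Coker)) ≃+ (B.map π).Coker,
      ∀ s m, e (s • m) = π s • e m := by
  let G : (Fin k → S) →ₛₗ[π] (B.map π).Coker :=
    { toFun := fun v => Submodule.Quotient.mk (π ∘ v)
      map_add' := fun v w => by
        rw [← Submodule.Quotient.mk_add]; congr 1; ext i; simp
      map_smul' := fun s v => by
        rw [← Submodule.Quotient.mk_smul]; congr 1; ext i; simp }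
  have h1 : LinearMap.range B.mulVecLin ≤ LinearMap.ker G := by
    rintro _ ⟨u, rfl⟩
    refine Matrix.Coker.mk_eq_zero.2 ⟨π ∘ u, ?_⟩
    ext i
    exact (RingHom.map_mulVec π B u i).symm
  let G' : B.Coker →ₛₗ[π] (B.map π).Coker := Submodule.liftQ _ G h1
  have h2 : (I • ⊤ : Submodule S B.Coker) ≤ LinearMap.ker G' := by
    rw [Submodule.smul_le]
    intro r hr m _
    rw [LinearMap.mem_ker, LinearMap.map_smulₛₗ, RingHom.mem_ker.1 (hI.ge hr), zero_smul]
  let G'' : (B.Coker ⧸ (I • ⊤ : Submodule S B.Coker)) →ₛₗ[π] (B.map π).Coker :=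
    Submodule.liftQ _ G' h2
  refine ⟨AddEquiv.ofBijective G'' ⟨(injective_iff_map_eq_zero _).2 fun x hx => ?_, fun x => ?_⟩,
    fun s m => G''.map_smulₛₗ s m⟩
  · obtain ⟨x, rfl⟩ := Submodule.Quotient.mk_surjective _ x
    obtain ⟨v, rfl⟩ := Submodule.Quotient.mk_surjective _ x
    obtain ⟨u, hu⟩ := Matrix.Coker.mk_eq_zero.1 (show (Submodule.Quotient.mk (π ∘ v) :
      (B.map π).Coker) = 0 from hx)
    choose t ht using fun j => hπ (u j)
    have h3 : (Submodule.Quotient.mk v : B.Coker) = Submodule.Quotient.mk (v - B.mulVec t) := by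
      rw [Submodule.Quotient.eq]
      exact ⟨t, by simp⟩
    have h4 : ∀ i, (v - B.mulVec t) i ∈ I := fun i => by
      rw [← hI, RingHom.mem_ker, Pi.sub_apply, map_sub, RingHom.map_mulVec,
        show π ∘ t = u from funext ht, congrFun hu i]
      exact sub_self _
    rw [Submodule.Quotient.mk_eq_zero, h3, pi_eq_sum_univ' (v - B.mulVec t),
      ← Submodule.mkQ_apply, map_sum]
    refine Submodule.sum_mem _ fun i _ => ?_
    rw [map_smul]
    exact Submodule.smul_mem_smul (h4 i) trivial
  · obtain ⟨v, rfl⟩ := Submodule.Quotient.mk_surjective _ x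
    choose t ht using fun j => hπ (v j)
    exact ⟨Submodule.Quotient.mk (Submodule.Quotient.mk t), congrArg Submodule.Quotient.mk
      (funext ht)⟩

section

open MvPolynomial

variable (R : Type u) [CommRing R] [IsLocalRing R] (ι : Type w)

/-- The maximal ideal at the origin of affine space over a local ring. -/
noncomputable abbrev originIdeal : Ideal (MvPolynomial ι R) := (maximalIdeal R).comap constantCoeff

/-- The local ring at the origin of affine space over a local ring. -/
abbrev LocalMvPolynomial := Localization.AtPrime (originIdeal R ι)

namespace LocalMvPolynomial

variable {ι} in
/-- The variables. -/
noncomputable abbrev X (i : ι) : LocalMvPolynomial R ι :=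
  algebraMap (MvPolynomial ι R) _ (MvPolynomial.X i)

/-- The constants. -/
noncomputable abbrev C : R →+* LocalMvPolynomial R ι :=
  (algebraMap (MvPolynomial ι R) _).comp MvPolynomial.C

variable {R ι}

lemma ringHom_ext {B : Type*} [CommRing B] {f g : LocalMvPolynomial R ι →+* B}
    (hC : ∀ r, f (C R ι r) = g (C R ι r)) (hX : ∀ i, f (X R i) = g (X R i)) : f = g :=
  IsLocalization.ringHom_ext (originIdeal R ι).primeCompl (MvPolynomial.ringHom_ext hC hX)

lemma exists_lift {B : Type*} [CommRing B] [IsLocalRing B] (φ : R →+* B) (b : ι → B)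
    (hb : ∀ i, b i ∈ maximalIdeal B) :
    ∃ f : LocalMvPolynomial R ι →+* B, (∀ r, f (C R ι r) = φ r) ∧ ∀ i, f (X R i) = b i := by
  have h (p : (originIdeal R ι).primeCompl) : IsUnit (eval₂Hom φ b p) := by
    obtain ⟨p, hp⟩ := p
    have h1 : IsUnit (φ (constantCoeff p)) := by
      have : constantCoeff p ∉ maximalIdeal R := hp
      exact (notMem_maximalIdeal.1 this).map φ
    have h2 : (residue B).comp (eval₂Hom φ b) = ((residue B).comp φ).comp constantCoeff := by
      refine MvPolynomial.ringHom_ext (by simp) fun i => ?_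
      simpa using (residue_eq_zero_iff _).2 (hb i)
    have h3 := RingHom.congr_fun h2 p
    by_contra h4
    exact (h1.map (residue B)).ne_zero (h3.symm.trans ((residue_eq_zero_iff _).2 h4))
  exact ⟨IsLocalization.lift h, fun r => by simp [C], fun i => by simp [X]⟩

lemma exists_subst [DecidableEq ι] (b : ι → LocalMvPolynomial R ι)
    (hb : ∀ i, b i ∈ maximalIdeal (LocalMvPolynomial R ι)) :
    ∃ θ : LocalMvPolynomial R ι →+* LocalMvPolynomial R ι, (∀ i, θ (X R i) = b i) ∧
      (∀ r, θ (C R ι r) = C R ι r) ∧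
      ∀ I : Ideal (LocalMvPolynomial R ι), (∀ i, b i - X R i ∈ I) → ∀ f, θ f - f ∈ I := by
  obtain ⟨θ, h1, h2⟩ := exists_lift (C R ι) b hb
  refine ⟨θ, h2, h1, fun I hI f => ?_⟩
  rw [← Ideal.Quotient.eq]
  refine RingHom.congr_fun (f := (Ideal.Quotient.mk I).comp θ) (g := Ideal.Quotient.mk I)
    (LocalMvPolynomial.ringHom_ext (B := LocalMvPolynomial R ι ⧸ I) (fun r => ?_) fun i => ?_) f
  · rw [RingHom.comp_apply, h1]
  · rw [RingHom.comp_apply, h2, Ideal.Quotient.eq]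
    exact hI i

lemma exists_eval (a : ι → R) (ha : ∀ i, a i ∈ maximalIdeal R) :
    ∃ π : LocalMvPolynomial R ι →+* R, (∀ r, π (C R ι r) = r) ∧ (∀ i, π (X R i) = a i) ∧
      RingHom.ker π = Ideal.span (Set.range fun i => X R i - C R ι (a i)) := by
  obtain ⟨π, h1, h2⟩ := exists_lift (ι := ι) (RingHom.id R) a ha
  refine ⟨π, h1, h2, le_antisymm (fun f hf => ?_) ?_⟩
  · set I := Ideal.span (Set.range fun i => X R i - C R ι (a i)) with hI
    have : ((Ideal.Quotient.mk I).comp (C R ι)).comp π = Ideal.Quotient.mk I := by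
      refine LocalMvPolynomial.ringHom_ext (B := LocalMvPolynomial R ι ⧸ I) (fun r => ?_) fun i => ?_
      · rw [RingHom.comp_apply, RingHom.comp_apply, h1, RingHom.id_apply]
      · rw [RingHom.comp_apply, RingHom.comp_apply, h2, eq_comm, Ideal.Quotient.eq]
        exact Ideal.subset_span ⟨i, rfl⟩
    rw [← Ideal.Quotient.eq_zero_iff_mem, ← RingHom.congr_fun this f, RingHom.comp_apply,
      RingHom.mem_ker.1 hf, map_zero]
  · rw [Ideal.span_le]
    rintro _ ⟨i, rfl⟩
    rw [SetLike.mem_coe, RingHom.mem_ker, map_sub, h1, h2, RingHom.id_apply, sub_self]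

lemma X_mem (i : ι) : X R i ∈ maximalIdeal (LocalMvPolynomial R ι) := by
  rw [X, IsLocalization.AtPrime.to_map_mem_maximal_iff _ (originIdeal R ι)]
  simp

lemma C_mem {r : R} (hr : r ∈ maximalIdeal R) :
    C R ι r ∈ maximalIdeal (LocalMvPolynomial R ι) := by
  rw [C, RingHom.comp_apply, IsLocalization.AtPrime.to_map_mem_maximal_iff _ (originIdeal R ι)]
  simpa using hr

lemma _root_.MvPolynomial.isWeaklyRegular_X {R : Type u} [CommRing R] {l : List ι} (hl : l.Nodup) :
    RingTheory.Sequence.IsWeaklyRegular (MvPolynomial ι R) (l.map (MvPolynomial.X (R := R))) := by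
  rw [RingTheory.Sequence.isWeaklyRegular_iff]
  intro j hj'
  rw [smul_eq_mul, Ideal.mul_top, isSMulRegular_quotient_iff_mem_of_smul_mem]
  intro f hf
  have hset : Ideal.ofList (List.take j (l.map MvPolynomial.X)) =
      Ideal.span (MvPolynomial.X '' {i | i ∈ l.take j} : Set (MvPolynomial ι R)) := by
    rw [← List.map_take]
    refine congrArg Ideal.span (Set.ext fun p => ?_)
    rw [Set.mem_ofPred_eq, List.mem_map]
    rfl
  rw [hset, MvPolynomial.mem_ideal_span_X_image] at hf ⊢
  have hj : j < l.length := by simpa using hj'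
  have hget : (l.map (MvPolynomial.X (R := R)))[j] = MvPolynomial.X l[j] := by simp
  intro m hm
  obtain ⟨i, hi, hmi⟩ := hf (Finsupp.single l[j] 1 + m) (by
    rw [MvPolynomial.mem_support_iff] at hm ⊢
    rw [hget, smul_eq_mul, MvPolynomial.coeff_X_mul]
    exact hm)
  refine ⟨i, hi, fun h0 => hmi ?_⟩
  have hne : l[j] ≠ i := by
    rintro rfl
    obtain ⟨j', hlt, h⟩ := List.mem_take_iff_getElem.1 hi
    have := hl.getElem_inj_iff.1 h
    omega
  rw [Finsupp.add_apply, h0, Finsupp.single_eq_of_ne (by first | exact hne | exact hne.symm)]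

variable [Fintype ι] [IsNoetherianRing R]

theorem isGenericFamily_X {c : ℕ} (hR : IsCM R c R) : IsGenericFamily c (X R (ι := ι)) := by
  classical
  obtain ⟨π, hπC, hπX, hker⟩ := exists_eval (R := R) (ι := ι) (fun _ => 0) (fun _ => zero_mem _)
  simp only [map_zero, sub_zero] at hker
  have hπ : Function.Surjective π := fun r => ⟨_, hπC r⟩
  have hofList : Ideal.ofList ((Finset.univ.toList.map MvPolynomial.X).map
      (algebraMap (MvPolynomial ι R) (LocalMvPolynomial R ι))) = RingHom.ker π := by
    rw [hker]
    refine congrArg Ideal.span (Set.ext fun p => ?_)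
    simp
  refine ⟨?_, X_mem, ?_, fun T => ?_⟩
  · have h1 := IsCM.of_isWeaklyRegular (S := LocalMvPolynomial R ι) (M := LocalMvPolynomial R ι)
      (d := c) _ ?_ (RingTheory.Sequence.IsWeaklyRegular.of_isLocalization (LocalMvPolynomial R ι)
        (originIdeal R ι).primeCompl
        (MvPolynomial.isWeaklyRegular_X (R := R) (Finset.nodup_toList (Finset.univ : Finset ι)))) ?_
    · simpa using h1
    · intro x hx
      simp only [List.map_map, List.mem_map, Function.comp_apply] at hx
      obtain ⟨i, -, rfl⟩ := hx
      exact X_mem i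
    · rw [hofList, smul_eq_mul, Ideal.mul_top]
      exact (IsCM.congr_semilinear π hπ c
        (RingHom.quotientKerEquivOfSurjective hπ).toAddEquiv (fun s m => by
          obtain ⟨m, rfl⟩ := Ideal.Quotient.mk_surjective m
          exact map_mul π s m)).2 hR
  · rw [← PrimeSpectrum.zeroLocus_span, zdim_zeroLocus, ← hker,
      ringKrullDim_eq_of_ringEquiv (RingHom.quotientKerEquivOfSurjective hπ),
      ← supportDim_self_eq_ringKrullDim]
    exact hR.supportDim_le
  · obtain ⟨θ, h1, -, h2⟩ := exists_subst (R := R) (fun i => if i ∈ T then 0 else X R i)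
      (fun i => by
        split_ifs
        · exact zero_mem _
        · exact X_mem i)
    refine ⟨θ, fun i hi => by rw [h1, if_pos hi], fun i hi => by rw [h1, if_neg hi],
      h2 _ fun i => ?_⟩
    split_ifs with hi
    · rw [zero_sub]
      exact neg_mem (Ideal.subset_span ⟨i, hi, rfl⟩)
    · rw [sub_self]
      exact zero_mem _

end LocalMvPolynomial

end

section Determinantal

variable {R : Type u} [CommRing R] [IsLocalRing R] [IsNoetherianRing R]

theorem IsCM.coker_of_mem_maximalIdeal {r : ℕ} (hR : IsCM R r R) {k n d : ℕ} (hkn : k ≤ n)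
    (A : Matrix (Fin k) (Fin n) R) (hA : ∀ i j, A i j ∈ maximalIdeal R)
    (hd : d + n + 1 = r + k) (hdim : supportDim R A.Coker ≤ d) : IsCM R d A.Coker := by
  let a : Fin k × Fin n → R := fun p => A p.1 p.2
  obtain ⟨π, hπC, hπX, hker⟩ := LocalMvPolynomial.exists_eval a fun p => hA _ _
  have hπ : Function.Surjective π := fun r => ⟨_, hπC r⟩
  set B : Matrix (Fin k) (Fin n) (LocalMvPolynomial R (Fin k × Fin n)) :=
    Matrix.of fun i j => LocalMvPolynomial.X R (i, j) with hB
  have hBA : B.map π = A := by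
    ext i j
    exact hπX (i, j)
  have hcard : Fintype.card (Fin k × Fin n) = k * n := by simp
  have hBCM : IsCM (LocalMvPolynomial R (Fin k × Fin n)) (d + k * n) B.Coker :=
    (LocalMvPolynomial.isGenericFamily_X (ι := Fin k × Fin n) hR).isCM_coker hkn Prod.mk
      Function.injective_id (by rw [hcard]; omega)
  let l : List (LocalMvPolynomial R (Fin k × Fin n)) := Finset.univ.toList.map fun p =>
    LocalMvPolynomial.X R p - LocalMvPolynomial.C R _ (a p)
  have hset : {x | x ∈ l} = Set.range fun p =>
      LocalMvPolynomial.X R p - LocalMvPolynomial.C R _ (a p) := by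
    ext x
    simp [l]
  have hl : l.length = k * n := by simp [l]
  have hlm : ∀ x ∈ l, x ∈ maximalIdeal (LocalMvPolynomial R (Fin k × Fin n)) := by
    intro x hx
    obtain ⟨p, -, rfl⟩ := List.mem_map.1 hx
    exact sub_mem (LocalMvPolynomial.X_mem p) (LocalMvPolynomial.C_mem (hA _ _))
  have hlker : RingHom.ker π = Ideal.ofList l := by rw [hker, ← hset]
  have hsl := B.exists_coker_quotient_semilinear π hπ hlker
  rw [hBA] at hsl
  obtain ⟨e, he⟩ := hsl
  refine (IsCM.congr_semilinear π hπ d e he).1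
    (IsCM.isWeaklyRegular_and_quotient l hlm (hl ▸ hBCM) ?_).2
  rwa [← supportDim_eq_of_semilinear π hπ e he, supportDim_eq_zdim, support_quotient,
    Ideal.ofList, PrimeSpectrum.zeroLocus_span] at hdim

end Determinantal

section Pivot

lemma Matrix.exists_coker_equiv_of_isUnit {R : Type u} [CommRing R] {k n : ℕ}
    (A : Matrix (Fin (k + 1)) (Fin (n + 1)) R) {i₀ : Fin (k + 1)} {j₀ : Fin (n + 1)}
    (h : IsUnit (A i₀ j₀)) :
    ∃ A' : Matrix (Fin k) (Fin n) R, Nonempty (A.Coker ≃ₗ[R] A'.Coker) := by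
  obtain ⟨b, hb⟩ := h.exists_right_inv
  let A' : Matrix (Fin k) (Fin n) R := Matrix.of fun i j =>
    A (i₀.succAbove i) (j₀.succAbove j) - A (i₀.succAbove i) j₀ * b * A i₀ (j₀.succAbove j)
  let Φ : (Fin (k + 1) → R) →ₗ[R] (Fin k → R) :=
    { toFun := fun v i => v (i₀.succAbove i) - A (i₀.succAbove i) j₀ * b * v i₀
      map_add' := fun v w => by ext i; simp; ring
      map_smul' := fun s v => by ext i; simp; ring }
  have hΦ : Function.Surjective Φ := fun v =>
    ⟨i₀.insertNth 0 v, by ext i; simp [Φ]⟩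
  have hA' : ∀ (w : Fin n → R) i, A'.mulVec w i = ∑ j, A (i₀.succAbove i) (j₀.succAbove j) * w j -
      A (i₀.succAbove i) j₀ * b * ∑ j, A i₀ (j₀.succAbove j) * w j := fun w i => by
    simp only [A', Matrix.mulVec, dotProduct, Matrix.of_apply, sub_mul, Finset.sum_sub_distrib,
      Finset.mul_sum, mul_assoc]
  have hA : ∀ (t : Fin (n + 1) → R) i, A.mulVec t i =
      A i j₀ * t j₀ + ∑ j, A i (j₀.succAbove j) * t (j₀.succAbove j) := fun t i => by
    simp only [Matrix.mulVec, dotProduct, Fin.sum_univ_succAbove _ j₀]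
  let F : (Fin (k + 1) → R) →ₗ[R] A'.Coker := (Submodule.mkQ _).comp Φ
  have hker : LinearMap.range A.mulVecLin = LinearMap.ker F := by
    apply le_antisymm
    · rintro _ ⟨t, rfl⟩
      refine Matrix.Coker.mk_eq_zero.2 ⟨fun j => t (j₀.succAbove j), ?_⟩
      ext i
      change _ = A.mulVec t _ - _ * A.mulVec t _
      rw [hA', hA, hA]
      linear_combination (A (i₀.succAbove i) j₀ * t j₀) * hb
    · intro v hv
      obtain ⟨w, hw⟩ := Matrix.Coker.mk_eq_zero.1 hv
      refine ⟨j₀.insertNth (b * (v i₀ - ∑ j, A i₀ (j₀.succAbove j) * w j)) w, ?_⟩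
      ext i
      rw [Matrix.mulVecLin_apply, hA]
      simp only [Fin.insertNth_apply_same, Fin.insertNth_apply_succAbove]
      obtain rfl | ⟨i, rfl⟩ := i₀.eq_self_or_eq_succAbove i
      · linear_combination (v i - ∑ j, A i (j₀.succAbove j) * w j) * hb
      · have := congrFun hw i
        rw [hA'] at this
        change _ = v _ - _ * v _ at this
        linear_combination this
  exact ⟨A', ⟨Submodule.quotEquivOfEq _ _ hker ≪≫ₗ
    F.quotKerEquivOfSurjective ((Submodule.mkQ_surjective _).comp hΦ)⟩⟩

variable {R : Type u} [CommRing R] [IsLocalRing R] [IsNoetherianRing R]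

/-- Over a Cohen–Macaulay local ring, the cokernel of a matrix is Cohen–Macaulay if its support has
the expected dimension. -/
theorem IsCM.coker {r : ℕ} (hR : IsCM R r R) {k n d : ℕ} (hkn : k ≤ n)
    (A : Matrix (Fin k) (Fin n) R) (hd : d + n + 1 = r + k) (hdim : supportDim R A.Coker ≤ d) :
    IsCM R d A.Coker := by
  induction k generalizing n with
  | zero => exact IsCM.of_subsingleton _ _
  | succ k ih =>
    by_cases hA : ∀ i j, A i j ∈ maximalIdeal R
    · exact hR.coker_of_mem_maximalIdeal hkn A hA hd hdim
    · push Not at hA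
      obtain ⟨i, j, hij⟩ := hA
      obtain ⟨n, rfl⟩ : ∃ m, n = m + 1 := ⟨n - 1, by omega⟩
      obtain ⟨A', ⟨e⟩⟩ := A.exists_coker_equiv_of_isUnit (notMem_maximalIdeal.1 hij)
      refine IsCM.congr e.symm (ih (by omega) A' (by omega) ?_)
      rwa [supportDim_eq_of_equiv e] at hdim

end Pivot

section MvPowerSeries

theorem IsCM.powerSeries {R : Type u} [CommRing R] [IsLocalRing R] [IsNoetherianRing R] {d : ℕ}
    (h : IsCM R d R) : IsCM (PowerSeries R) (d + 1) (PowerSeries R) := by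
  have hX : ∀ f : PowerSeries R, f ∈ ((PowerSeries.X : PowerSeries R) • ⊤ :
      Submodule (PowerSeries R) (PowerSeries R)) ↔ PowerSeries.constantCoeff f = 0 := fun f => by
    rw [Submodule.mem_smul_pointwise_iff_exists, ← PowerSeries.X_dvd_iff]
    exact ⟨fun ⟨g, _, hg⟩ => ⟨g, hg.symm⟩, fun ⟨g, hg⟩ => ⟨g, trivial, hg.symm⟩⟩
  refine IsCM.of_quotSMulTop (x := PowerSeries.X) ?_ ?_ ?_
  · rw [mem_maximalIdeal, mem_nonunits_iff, PowerSeries.isUnit_iff_constantCoeff,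
      PowerSeries.constantCoeff_X]
    exact not_isUnit_zero
  · intro f g hfg
    exact PowerSeries.X_mul_inj.1 hfg
  · let F : PowerSeries R →ₛₗ[(PowerSeries.constantCoeff : PowerSeries R →+* R)] R :=
      { toFun := PowerSeries.constantCoeff
        map_add' := map_add _
        map_smul' := fun f g => map_mul _ f g }
    have hle : (PowerSeries.X • ⊤ : Submodule (PowerSeries R) (PowerSeries R)) ≤ LinearMap.ker F :=
      fun f hf => (hX f).1 hf
    refine (IsCM.congr_semilinear (PowerSeries.constantCoeff (R := R)) PowerSeries.constantCoeff_surj d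
      (AddEquiv.ofBijective (Submodule.liftQ _ F hle)
        ⟨(injective_iff_map_eq_zero _).2 fun x hx => ?_, fun r =>
          ⟨Submodule.Quotient.mk (PowerSeries.C r), PowerSeries.constantCoeff_C r⟩⟩)
      (fun s m => (Submodule.liftQ _ F hle).map_smulₛₗ s m)).2 h
    obtain ⟨f, rfl⟩ := Submodule.Quotient.mk_surjective _ x
    exact (Submodule.Quotient.mk_eq_zero _).2 ((hX f).2 hx)

theorem MvPowerSeries.isCM (K : Type u) [Field K] (n : ℕ) :
    IsCM (MvPowerSeries (Fin n) K) n (MvPowerSeries (Fin n) K) := by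
  induction n with
  | zero =>
    rw [IsCM, supportDim_self_eq_ringKrullDim,
      ringKrullDim_eq_of_ringEquiv (MvPowerSeries.isEmptyEquiv (Fin 0) K).toRingEquiv,
      ringKrullDim_eq_zero_of_field]
  | succ n ih =>
    exact (IsCM.congr_semilinear (MvPowerSeries.finSuccEquiv K n : _ →+* _)
      (MvPowerSeries.finSuccEquiv K n).surjective (n + 1)
      (MvPowerSeries.finSuccEquiv K n).toAddEquiv
      (fun s m => map_mul (MvPowerSeries.finSuccEquiv K n) s m)).2 ih.powerSeries

end MvPowerSeries

section Minors

lemma Matrix.exists_minor_ne_zero {F : Type u} [Field F] {k n : ℕ} (A : Matrix (Fin k) (Fin n) F)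
    (hA : Function.Surjective A.mulVec) :
    ∃ c : Fin k ↪o Fin n, (A.submatrix id c).det ≠ 0 := by
  obtain ⟨κ, a, ha, hspan, hli⟩ := exists_linearIndependent' F A.col
  have := Finite.of_injective a ha
  have := Fintype.ofFinite κ
  have hcard : Fintype.card κ = k := by
    have h1 := finrank_span_eq_card hli
    rw [hspan, ← Matrix.range_mulVecLin, LinearMap.range_eq_top.2 hA, finrank_top,
      Module.finrank_fin_fun] at h1
    exact h1.symm
  let s : Finset (Fin n) := Finset.univ.map ⟨a, ha⟩
  have hs : s.card = k := by rw [Finset.card_map, Finset.card_univ, hcard]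
  refine ⟨s.orderEmbOfFin hs, ?_⟩
  rw [← isUnit_iff_ne_zero, ← Matrix.isUnit_iff_isUnit_det,
    ← Matrix.linearIndependent_cols_iff_isUnit]
  refine (linearIndepOn_range_iff (s.orderEmbOfFin hs).injective A.col).1 ?_
  rw [Finset.range_orderEmbOfFin, Finset.coe_map, Finset.coe_univ, Set.image_univ]
  exact (linearIndepOn_range_iff ha A.col).2 hli

variable {R : Type u} [CommRing R]

lemma Matrix.minor_smul_coker {k n : ℕ} (A : Matrix (Fin k) (Fin n) R) (c : Fin k → Fin n)
    (v : A.Coker) : (A.submatrix id c).det • v = 0 := by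
  obtain ⟨v, rfl⟩ := Submodule.Quotient.mk_surjective _ v
  rw [← Submodule.Quotient.mk_smul, Submodule.Quotient.mk_eq_zero]
  have h1 : LinearMap.range (A.submatrix id c).mulVecLin ≤ LinearMap.range A.mulVecLin := by
    rw [Matrix.range_mulVecLin, Matrix.range_mulVecLin]
    refine Submodule.span_mono ?_
    rintro _ ⟨j, rfl⟩
    exact ⟨c j, rfl⟩
  refine h1 ⟨(A.submatrix id c).adjugate.mulVec v, ?_⟩
  rw [Matrix.mulVecLin_apply, Matrix.mulVec_mulVec, Matrix.mul_adjugate, Matrix.smul_mulVec,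
    Matrix.one_mulVec]

/-- The ideal of maximal minors. -/
def Matrix.minorIdeal {k n : ℕ} (A : Matrix (Fin k) (Fin n) R) : Ideal R :=
  Ideal.span {d | ∃ c : Fin k ↪o Fin n, d = (A.submatrix id c).det}

lemma Matrix.support_coker_subset_zeroLocus {k n : ℕ} (A : Matrix (Fin k) (Fin n) R) :
    support R A.Coker ⊆ PrimeSpectrum.zeroLocus A.minorIdeal := by
  intro p hp
  rw [Matrix.minorIdeal, PrimeSpectrum.zeroLocus_span]
  rintro _ ⟨c, rfl⟩
  exact annihilator_le_of_mem_support hp (mem_annihilator.2 (A.minor_smul_coker c))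

variable [IsLocalRing R]

lemma Matrix.nontrivial_coker {k n : ℕ} (A : Matrix (Fin k) (Fin n) R)
    (hA : A.minorIdeal ≠ ⊤) : Nontrivial A.Coker := by
  rw [Submodule.Quotient.nontrivial_iff]
  intro h
  obtain ⟨c, hc⟩ := (A.map (residue R)).exists_minor_ne_zero fun v => by
    choose t ht using fun i => residue_surjective (v i)
    obtain ⟨u, hu⟩ := LinearMap.range_eq_top.1 h t
    refine ⟨residue R ∘ u, ?_⟩
    ext i
    rw [← RingHom.map_mulVec, ← ht]
    exact congrArg (residue R) (congrFun hu i)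
  refine hc ?_
  have h1 : (A.submatrix id c).det ∈ maximalIdeal R :=
    le_maximalIdeal hA (Ideal.subset_span ⟨c, rfl⟩)
  rw [← residue_eq_zero_iff, RingHom.map_det] at h1
  exact h1

variable [IsNoetherianRing R]

/-- If the ideal of maximal minors has the expected codimension, then any sequence of parameters
modulo that ideal is regular on the cokernel. -/
theorem Matrix.isRegular_coker {r : ℕ} (hR : IsCM R r R) {k n d : ℕ} (hkn : k ≤ n)
    (A : Matrix (Fin k) (Fin n) R) (hd : d + n + 1 = r + k)
    (hdim : ringKrullDim (R ⧸ A.minorIdeal) ≤ d) (g : Fin d → R)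
    (hg : ringKrullDim (R ⧸ (Ideal.span (Set.range g) ⊔ A.minorIdeal)) = 0) :
    RingTheory.Sequence.IsRegular A.Coker (List.ofFn g) := by
  have hne : Ideal.span (Set.range g) ⊔ A.minorIdeal ≠ ⊤ := by
    intro h
    have : Subsingleton (R ⧸ (Ideal.span (Set.range g) ⊔ A.minorIdeal)) :=
      Ideal.Quotient.subsingleton_iff.2 h
    rw [ringKrullDim_eq_bot_of_subsingleton] at hg
    exact absurd hg (by simp)
  have hle := le_maximalIdeal hne
  have : Nontrivial A.Coker :=
    A.nontrivial_coker fun h => hne (top_le_iff.1 (h ▸ le_sup_right))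
  have hmem : ∀ x ∈ List.ofFn g, x ∈ maximalIdeal R := by
    intro x hx
    obtain ⟨i, rfl⟩ := (List.mem_ofFn' g x).1 hx
    exact hle (le_sup_left (α := Ideal R) (Ideal.subset_span ⟨i, rfl⟩))
  have hsupp : supportDim R A.Coker ≤ d := by
    rw [supportDim_eq_zdim]
    refine (zdim_mono A.support_coker_subset_zeroLocus).trans ?_
    rwa [zdim_zeroLocus]
  refine RingTheory.Sequence.IsRegular.of_isWeaklyRegular_of_mem_maximalIdeal _ hmem
    (IsCM.isWeaklyRegular_and_quotient (d := 0) _ hmem ?_ ?_).1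
  · rw [List.length_ofFn, zero_add]
    exact hR.coker hkn A hd hsupp
  · refine le_trans (zdim_mono ?_) ((zdim_zeroLocus _).trans hg).le
    rw [PrimeSpectrum.zeroLocus_sup, PrimeSpectrum.zeroLocus_span, Set.inter_comm]
    refine Set.inter_subset_inter (PrimeSpectrum.zeroLocus_anti_mono ?_)
      A.support_coker_subset_zeroLocus
    rintro _ ⟨i, rfl⟩
    exact (List.mem_ofFn' g _).2 ⟨i, rfl⟩

end Minors

end

/-- **Lemma (regular sequence on the cokernel of the Jacobian).**
Let `R = ℂ⟦x₁,…,xₙ⟧`, `1 ≤ k ≤ n`, `A` a `k × n` matrix over `R` and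
`I_k(A)` the ideal of its `k × k` minors. If `dim R/I_k(A) = k - 1` and
`g₁, …, g_{k-1} ∈ R` are such that `R/((g₁,…,g_{k-1}) + I_k(A))` has Krull
dimension `0`, then `g₁, …, g_{k-1}` is a regular sequence on the cokernel
`M = R^k / A(Rⁿ)`. -/
theorem regular_sequence_on_cokernel_of_jacobian
    (n k : ℕ) (hk : 1 ≤ k) (hkn : k ≤ n)
    (A : Matrix (Fin k) (Fin n) (MvPowerSeries (Fin n) ℂ))
    (Ik : Ideal (MvPowerSeries (Fin n) ℂ))
    (hIk : Ik = Ideal.span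
      {d : MvPowerSeries (Fin n) ℂ | ∃ c : Fin k ↪o Fin n, d = (A.submatrix id c).det})
    (hdim : ringKrullDim (MvPowerSeries (Fin n) ℂ ⧸ Ik) = ((k - 1 : ℕ) : WithBot (WithTop ℕ)))
    (g : Fin (k - 1) → MvPowerSeries (Fin n) ℂ)
    (hg : ringKrullDim
      (MvPowerSeries (Fin n) ℂ ⧸ (Ideal.span (Set.range g) ⊔ Ik)) = 0) :
    RingTheory.Sequence.IsRegular
      ((Fin k → MvPowerSeries (Fin n) ℂ) ⧸ LinearMap.range A.mulVecLin)
      (List.ofFn g) := by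
  subst hIk
  exact A.isRegular_coker (MvPowerSeries.isCM ℂ n) hkn (by omega) hdim.le g hg
end
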